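/- arXiv:0809.1391 — 2 statements merged into one kernel-verified Lean document; each statement's English description precedes it below -/
import Mathlib

section
/- For every integer g ≥ 4 and every τ ∈ ℍ_g: (2^{2g−4} − 1)·S_{2,4}^g(τ) = 42·S_{3,2}^g(τ) + 840·S_{4,1}^g(τ). -/
open scoped BigOperators

noncomputable section

/-- The Siegel upper half-space: symmetric complex matrices with positive
definite imaginary part (indexed by a finite type `ι`). -/
def Siegel (ι : Type) [Fintype ι] : Set (Matrix ι ι ℂ) :=
  {τ | τ.IsSymm ∧ ∀ v : ι → ℝ, v ≠ 0 → 0 < ∑ i, ∑ j, v i * (τ i j).im * v j}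

/-- The theta function with characteristic `[ε, δ]`. -/
def theta {ι : Type} [Fintype ι] (ε δ : ι → ZMod 2) (τ : Matrix ι ι ℂ) (z : ι → ℂ) : ℂ :=
  ∑' n : ι → ℤ, Complex.exp ((Real.pi : ℂ) * Complex.I *
    ((∑ i, ∑ j, ((n i : ℂ) + ((ε i).val : ℂ) / 2) * τ i j * ((n j : ℂ) + ((ε j).val : ℂ) / 2)) +
     2 * ∑ i, ((n i : ℂ) + ((ε i).val : ℂ) / 2) * (z i + ((δ i).val : ℂ) / 2)))

/-- A theta characteristic, an element of `𝔽₂^{2g}`. -/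
abbrev Char2 (ι : Type) := (ι → ZMod 2) × (ι → ZMod 2)

/-- Theta function, with the characteristic as a pair. -/
def thetaChar {ι : Type} [Fintype ι] (m : Char2 ι) (τ : Matrix ι ι ℂ) (z : ι → ℂ) : ℂ :=
  theta m.1 m.2 τ z

/-- Theta constant. -/
def thetaConst {ι : Type} [Fintype ι] (m : Char2 ι) (τ : Matrix ι ι ℂ) : ℂ :=
  thetaChar m τ 0

/-- `W` is (the underlying finite set of) an `i`-dimensional affine subspace of `𝔽₂^{2g}`,
i.e. a coset of an `i`-dimensional linear subspace. -/
def IsAffineCosetDim {ι : Type} [Fintype ι] (i : ℕ) (W : Finset (Char2 ι)) : Prop :=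
  ∃ (V : Submodule (ZMod 2) (Char2 ι)) (x : Char2 ι),
    Module.finrank (ZMod 2) V = i ∧ (W : Set (Char2 ι)) = (fun v => x + v) '' (V : Set (Char2 ι))

/-- The modular form `S_{i,s}^g(τ) = Σ_W (Π_{w∈W} θ_w(τ))^s`, the sum over all
`i`-dimensional affine subspaces `W` of `𝔽₂^{2g}`, each counted once. -/
noncomputable def Sform (ι : Type) [Fintype ι] (i s : ℕ) (τ : Matrix ι ι ℂ) : ℂ :=
  letI := Classical.propDecidable
  ∑ W ∈ Finset.univ.filter (fun W : Finset (Char2 ι) => IsAffineCosetDim i W),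
    (∏ w ∈ W, thetaConst w τ) ^ s

/-! ### The theta constants as sums over the integer lattice -/

/-- The Gaussian factor `exp (πi/4 · Xᵀ τ X)` at a lattice point. -/
def latticeTerm {ι : Type} [Fintype ι] (τ : Matrix ι ι ℂ) (X : ι → ℤ) : ℂ :=
  Complex.exp ((Real.pi : ℂ) * Complex.I / 4 * ∑ i, ∑ j, (X i : ℂ) * τ i j * (X j : ℂ))

/-- The weight `i ^ (x d)`, supported on the integers `x` congruent to `e` modulo two. -/
def charWeight (e d : ZMod 2) (x : ℤ) : ℂ :=
  if (x : ZMod 2) = e then Complex.I ^ (x * d.val) else 0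

lemma norm_charWeight_le (e d : ZMod 2) (x : ℤ) : ‖charWeight e d x‖ ≤ 1 := by
  unfold charWeight
  split_ifs <;> simp

lemma intCast_two_mul_add_val (e : ZMod 2) (n : ℤ) : ((2 * n + (e.val : ℤ) : ℤ) : ZMod 2) = e := by
  have h2 : (2 : ZMod 2) = 0 := rfl
  push_cast
  rw [h2, zero_mul, zero_add, ZMod.natCast_zmod_val]

lemma exists_two_mul_add_val {e : ZMod 2} {x : ℤ} (h : (x : ZMod 2) = e) :
    ∃ n : ℤ, 2 * n + (e.val : ℤ) = x := by
  have h0 : ((x - (e.val : ℤ) : ℤ) : ZMod 2) = 0 := by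
    push_cast
    rw [h, ZMod.natCast_zmod_val, sub_self]
  obtain ⟨n, hn⟩ := (ZMod.intCast_zmod_eq_zero_iff_dvd _ 2).mp h0
  exact ⟨n, by push_cast at hn; linarith⟩

lemma I_zpow_eq_exp (k : ℤ) : Complex.I ^ k = Complex.exp (k * (Real.pi / 2 * Complex.I)) := by
  rw [Complex.exp_int_mul, Complex.exp_pi_div_two_mul_I]

lemma thetaConst_eq_tsum {ι : Type} [Fintype ι] (m : Char2 ι) (τ : Matrix ι ι ℂ) :
    thetaConst m τ = ∑' X : ι → ℤ, (∏ j, charWeight (m.1 j) (m.2 j) (X j)) * latticeTerm τ X := by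
  let φ : (ι → ℤ) → ι → ℤ := fun n j => 2 * n j + ((m.1 j).val : ℤ)
  have hφ : Function.Injective φ := by
    intro a b h
    funext j
    have := congrFun h j
    simp only [φ] at this
    linarith
  rw [← hφ.tsum_eq]
  · unfold thetaConst thetaChar theta
    refine tsum_congr fun n => ?_
    have hw : ∀ j, charWeight (m.1 j) (m.2 j) (φ n j) =
        Complex.exp ((Real.pi : ℂ) * Complex.I *
          (2 * (((n j : ℂ) + ((m.1 j).val : ℂ) / 2) * (((m.2 j).val : ℂ) / 2)))) := by
      intro j
      unfold charWeight
      rw [if_pos (intCast_two_mul_add_val _ _), I_zpow_eq_exp]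
      congr 1
      simp only [φ]
      push_cast
      ring
    simp_rw [hw]
    rw [← Complex.exp_sum, latticeTerm, ← Complex.exp_add]
    congr 1
    rw [mul_add, add_comm, ← Finset.mul_sum, ← Finset.mul_sum]
    congr 1
    · simp
    · simp only [Finset.mul_sum]
      refine Finset.sum_congr rfl fun i _ => Finset.sum_congr rfl fun j _ => ?_
      simp only [φ]
      push_cast
      ring
  · intro X hX
    rw [Function.mem_support] at hX
    have h : ∀ j, ∃ n : ℤ, 2 * n + ((m.1 j).val : ℤ) = X j := by
      intro j
      apply exists_two_mul_add_val
      by_contra hj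
      apply hX
      rw [Finset.prod_eq_zero (Finset.mem_univ j), zero_mul]
      exact if_neg hj
    choose n hn using h
    exact ⟨n, funext hn⟩

/-! ### Absolute convergence -/

lemma summable_prod_apply {f : ℤ → ℝ} (hf : Summable f) (hf0 : ∀ x, 0 ≤ f x) (n : ℕ) :
    Summable fun X : Fin n → ℤ => ∏ j, f (X j) := by
  induction n with
  | zero => exact Summable.of_finite
  | succ n ih =>
    rw [← (Fin.consEquiv fun _ => ℤ).summable_iff]
    have h := hf.mul_of_nonneg ih hf0 fun X => Finset.prod_nonneg fun j _ => hf0 _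
    refine h.congr fun p => ?_
    simp [Fin.prod_univ_succ, Fin.consEquiv]

lemma exists_pos_mul_sum_sq_le {ι : Type} [Fintype ι] {τ : Matrix ι ι ℂ} (hτ : τ ∈ Siegel ι) :
    ∃ c : ℝ, 0 < c ∧ ∀ v : ι → ℝ, c * ∑ i, v i ^ 2 ≤ ∑ i, ∑ j, v i * (τ i j).im * v j := by
  classical
  let q : EuclideanSpace ℝ ι → ℝ := fun v => ∑ i, ∑ j, v i * (τ i j).im * v j
  have hq : Continuous q := by fun_prop
  have hpos : ∀ v : EuclideanSpace ℝ ι, v ≠ 0 → 0 < q v := by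
    intro v hv
    apply hτ.2
    intro h
    apply hv
    ext i
    exact congrFun h i
  have hsmul : ∀ (r : ℝ) (v : EuclideanSpace ℝ ι), q (r • v) = r ^ 2 * q v := by
    intro r v
    simp only [q, Finset.mul_sum, PiLp.smul_apply, smul_eq_mul]
    refine Finset.sum_congr rfl fun i _ => Finset.sum_congr rfl fun j _ => ?_
    ring
  have key : ∃ c : ℝ, 0 < c ∧ ∀ v : EuclideanSpace ℝ ι, c * ‖v‖ ^ 2 ≤ q v := by
    rcases (Metric.sphere (0 : EuclideanSpace ℝ ι) 1).eq_empty_or_nonempty with he | hne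
    · refine ⟨1, one_pos, fun v => ?_⟩
      have hv : v = 0 := by
        by_contra hv
        have : ‖v‖⁻¹ • v ∈ Metric.sphere (0 : EuclideanSpace ℝ ι) 1 := by
          simp [norm_smul, norm_ne_zero_iff.mpr hv]
        simp [he] at this
      simp [hv, q]
    · obtain ⟨u, hu, hmin⟩ := (isCompact_sphere (0 : EuclideanSpace ℝ ι) 1).exists_isMinOn hne
        hq.continuousOn
      have hu0 : u ≠ 0 := by
        rintro rfl
        simp at hu
      refine ⟨q u, hpos u hu0, fun v => ?_⟩
      by_cases hv : v = 0
      · simp [hv, q]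
      have hn : ‖v‖ ≠ 0 := norm_ne_zero_iff.mpr hv
      have h1 : q u ≤ q (‖v‖⁻¹ • v) := hmin (by simp [norm_smul, hn])
      rw [hsmul, inv_pow, ← div_eq_inv_mul, le_div_iff₀ (by positivity)] at h1
      exact h1
  obtain ⟨c, hc, h⟩ := key
  refine ⟨c, hc, fun v => ?_⟩
  have := h (WithLp.toLp 2 v)
  rw [EuclideanSpace.real_norm_sq_eq] at this
  exact this

lemma norm_latticeTerm {ι : Type} [Fintype ι] (τ : Matrix ι ι ℂ) (X : ι → ℤ) :
    ‖latticeTerm τ X‖ = Real.exp (-(Real.pi / 4) * ∑ i, ∑ j, (X i : ℝ) * (τ i j).im * (X j : ℝ)) := by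
  rw [latticeTerm, Complex.norm_exp]
  congr 1
  have h : (∑ i, ∑ j, (X i : ℂ) * τ i j * (X j : ℂ)).im =
      ∑ i, ∑ j, (X i : ℝ) * (τ i j).im * (X j : ℝ) := by
    simp [Complex.im_sum, Complex.mul_im]
  rw [← h]
  have e : (Real.pi : ℂ) * Complex.I / 4 = ((Real.pi / 4 : ℝ) : ℂ) * Complex.I := by
    push_cast
    ring
  rw [e, mul_assoc, Complex.re_ofReal_mul, Complex.I_mul_re]
  ring

lemma summable_norm_latticeTerm {g : ℕ} {τ : Matrix (Fin g) (Fin g) ℂ} (hτ : τ ∈ Siegel (Fin g)) :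
    Summable fun X : Fin g → ℤ => ‖latticeTerm τ X‖ := by
  obtain ⟨c, hc, h⟩ := exists_pos_mul_sum_sq_le hτ
  have h1 : Summable fun n : ℤ => Real.exp (-(Real.pi / 4) * c * (n : ℝ) ^ 2) := by
    refine (summable_pow_mul_jacobiTheta₂_term_bound 0 (T := c / 4) (by positivity) 0).congr
      fun n => ?_
    rw [pow_zero, one_mul]
    congr 1
    ring
  refine (summable_prod_apply h1 (fun _ => (Real.exp_pos _).le) g).of_nonneg_of_le
    (fun _ => norm_nonneg _) fun X => ?_
  rw [norm_latticeTerm, ← Real.exp_sum, Real.exp_le_exp, ← Finset.mul_sum, mul_assoc]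
  exact mul_le_mul_of_nonpos_left (h fun i => X i) (by have := Real.pi_pos; linarith)

lemma summable_norm_thetaTerm {g : ℕ} {τ : Matrix (Fin g) (Fin g) ℂ} (hτ : τ ∈ Siegel (Fin g))
    (m : Char2 (Fin g)) :
    Summable fun X : Fin g → ℤ =>
      ‖(∏ j, charWeight (m.1 j) (m.2 j) (X j)) * latticeTerm τ X‖ := by
  refine (summable_norm_latticeTerm hτ).of_nonneg_of_le (fun _ => norm_nonneg _) fun X => ?_
  rw [norm_mul, norm_prod]
  exact mul_le_of_le_one_left (norm_nonneg _)
    (Finset.prod_le_one (fun _ _ => norm_nonneg _) fun j _ => norm_charWeight_le _ _ _)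

/-! ### The one-dimensional Riemann relation -/

/-- The nontrivial additive character of `𝔽₂`. -/
def binSign (x : ZMod 2) : ℂ := if x = 0 then 1 else -1

/-- The reflection `½ · Hadamard` of `ℤ⁴` where it is integral, and the identity elsewhere. -/
def hadamard (x : (ℤ × ℤ) × (ℤ × ℤ)) : (ℤ × ℤ) × (ℤ × ℤ) :=
  if (x.1.1 + x.1.2 + x.2.1 + x.2.2) % 2 = 0 then
    (((x.1.1 + x.1.2 + x.2.1 + x.2.2) / 2, (x.1.1 + x.1.2 - x.2.1 - x.2.2) / 2),
      ((x.1.1 - x.1.2 + x.2.1 - x.2.2) / 2, (x.1.1 - x.1.2 - x.2.1 + x.2.2) / 2))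
  else x

lemma hadamard_involutive : Function.Involutive hadamard := by
  rintro ⟨⟨p, q⟩, r, s⟩
  by_cases h : (p + q + r + s) % 2 = 0
  · simp only [hadamard, h, if_true]
    rw [if_pos (by omega)]
    simp only [Prod.mk.injEq]
    omega
  · simp only [hadamard, h, if_false]

/-- The weight of a point of `ℤ⁴` in the product of the four theta constants whose
characteristics form the affine plane through `c` with directions `a` and `b`. -/
def quadWeight (a b c : ZMod 2 × ZMod 2) (x : (ℤ × ℤ) × (ℤ × ℤ)) : ℂ :=
  (charWeight c.1 c.2 x.1.1 * charWeight (c.1 + a.1) (c.2 + a.2) x.1.2) *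
    (charWeight (c.1 + b.1) (c.2 + b.2) x.2.1 *
      charWeight (c.1 + a.1 + b.1) (c.2 + a.2 + b.2) x.2.2)

/-- The shift of characteristics in the Riemann relation. -/
def riemannShift (a b : ZMod 2 × ZMod 2) : ZMod 2 × ZMod 2 :=
  (a.1 * b.2 + b.1 * a.2, a.2 + b.2 + a.2 * b.2)

lemma I_zpow_congr {m n : ℤ} (h : (m - n) % 4 = 0) : Complex.I ^ m = Complex.I ^ n := by
  obtain ⟨k, hk⟩ := Int.dvd_of_emod_eq_zero h
  rw [show m = n + 4 * k by omega, zpow_add₀ Complex.I_ne_zero, zpow_mul,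
    show Complex.I ^ (4 : ℤ) = 1 from Complex.I_pow_four, one_zpow, mul_one]

lemma I_zpow_congr_neg {m n : ℤ} (h : (m - n) % 4 = 2) : Complex.I ^ m = -Complex.I ^ n := by
  rw [I_zpow_congr (m := m) (n := n + 2) (by omega), zpow_add₀ Complex.I_ne_zero,
    show Complex.I ^ (2 : ℤ) = -1 from Complex.I_sq]
  ring

lemma quadWeight_eq_zero {a b c : ZMod 2 × ZMod 2} {x : (ℤ × ℤ) × (ℤ × ℤ)}
    (h : ¬ (x.1.1 + x.1.2 + x.2.1 + x.2.2) % 2 = 0) : quadWeight a b c x = 0 := by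
  obtain ⟨⟨p, q⟩, r, s⟩ := x
  by_contra hne
  simp only [quadWeight, charWeight, mul_eq_zero, not_or, ite_eq_right_iff, not_forall] at hne
  obtain ⟨⟨⟨h1, -⟩, h2, -⟩, ⟨h3, -⟩, h4, -⟩ := hne
  apply h
  have h0 : ((p + q + r + s : ℤ) : ZMod 2) = 0 := by
    push_cast
    rw [h1, h2, h3, h4]
    generalize c.1 = u
    generalize a.1 = v
    generalize b.1 = w
    revert u v w
    decide
  exact Int.emod_eq_zero_of_dvd ((ZMod.intCast_zmod_eq_zero_iff_dvd _ 2).mp h0)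

lemma zmod_two_cases (x : ZMod 2) : x = 0 ∨ x = 1 := by
  revert x
  decide

lemma binSign_eq_zpow (x : ZMod 2) : binSign x = Complex.I ^ (2 * (x.val : ℤ)) := by
  rcases zmod_two_cases x with rfl | rfl
  · simp [binSign]
  · rw [ZMod.val_one'' (by norm_num), binSign, if_neg one_ne_zero]
    exact Complex.I_sq.symm

lemma emod_two_eq_val {e : ZMod 2} {x : ℤ} (h : (x : ZMod 2) = e) : x % 2 = (e.val : ℤ) := by
  rw [← h, ZMod.val_intCast]
  rfl

/-- The exponent of `i` in `quadWeight` on its support. -/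
def quadExp (a b d : ZMod 2) (p q r s : ℤ) : ℤ :=
  (p * d.val + q * (d + a).val) + (r * (d + b).val + s * (d + a + b).val)

lemma quadWeight_eq_ite {a b c : ZMod 2 × ZMod 2} {p q r s : ℤ}
    (hq : (q : ZMod 2) = p + a.1) (hr : (r : ZMod 2) = p + b.1)
    (hs : (s : ZMod 2) = p + a.1 + b.1) :
    quadWeight a b c ((p, q), (r, s)) =
      if (p : ZMod 2) = c.1 then Complex.I ^ quadExp a.2 b.2 c.2 p q r s else 0 := by
  by_cases h : (p : ZMod 2) = c.1
  · simp only [quadWeight, charWeight, quadExp, hq, hr, hs, h, if_true,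
      zpow_add₀ Complex.I_ne_zero]
  · simp [quadWeight, charWeight, h]

lemma quadWeight_ne_zero {a b c : ZMod 2 × ZMod 2} {p q r s : ℤ}
    (h : quadWeight a b c ((p, q), (r, s)) ≠ 0) :
    (q : ZMod 2) = p + a.1 ∧ (r : ZMod 2) = p + b.1 ∧ (s : ZMod 2) = p + a.1 + b.1 := by
  simp only [quadWeight, charWeight, ne_eq, mul_eq_zero, not_or, ite_eq_right_iff,
    not_forall] at h
  obtain ⟨⟨⟨h1, -⟩, h2, -⟩, ⟨h3, -⟩, h4, -⟩ := h
  simp [h1, h2, h3, h4]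

set_option maxHeartbeats 4000000 in
lemma quadExp_emod_four (a b ξ : ZMod 2 × ZMod 2) (u v : ZMod 2) (p q r s y : ℤ)
    (hp : p % 2 = (u.val : ℤ)) (hq : q % 2 = ((u + a.1).val : ℤ))
    (hr : r % 2 = ((u + b.1).val : ℤ)) (hsum : p + q + r + s = 2 * y)
    (hy : y % 2 = (v.val : ℤ)) :
    (v = ξ.1 + (riemannShift a b).1 → ∀ d : ZMod 2,
      (2 * ((ξ.1 * d + ξ.2 * u).val : ℤ) + quadExp a.2 b.2 d p q r s
        - (2 * (((riemannShift a b).2 * ξ.1 + (riemannShift a b).1 * ξ.2).val : ℤ) +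
          quadExp a.2 b.2 (ξ.2 + (riemannShift a b).2) y (p + q - y) (p + r - y) (p + s - y)))
        % 4 = 0) ∧
    (v ≠ ξ.1 + (riemannShift a b).1 →
      (2 * ((ξ.1 * 0 + ξ.2 * u).val : ℤ) + quadExp a.2 b.2 0 p q r s
        - (2 * ((ξ.1 * 1 + ξ.2 * u).val : ℤ) + quadExp a.2 b.2 1 p q r s)) % 4 = 2) := by
  obtain ⟨a₁, a₂⟩ := a
  obtain ⟨b₁, b₂⟩ := b
  obtain ⟨ξ₁, ξ₂⟩ := ξ
  obtain rfl : s = 2 * y - p - q - r := by omega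
  have v0 : ((0 : ZMod 2).val : ℤ) = 0 := rfl
  have v1 : ((1 : ZMod 2).val : ℤ) = 1 := rfl
  have h11 : (1 + 1 : ZMod 2) = 0 := rfl
  have h01 : ¬ (0 : ZMod 2) = 1 := by decide
  have h10 : ¬ (1 : ZMod 2) = 0 := by decide
  have all : ∀ P : ZMod 2 → Prop, (∀ d, P d) ↔ P 0 ∧ P 1 := fun P =>
    ⟨fun h => ⟨h 0, h 1⟩, fun h d => by rcases zmod_two_cases d with rfl | rfl; exacts [h.1, h.2]⟩
  simp only [quadExp, riemannShift, all] at hq hr ⊢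
  rcases zmod_two_cases a₁ with rfl | rfl <;> rcases zmod_two_cases a₂ with rfl | rfl <;>
  rcases zmod_two_cases b₁ with rfl | rfl <;> rcases zmod_two_cases b₂ with rfl | rfl <;>
  rcases zmod_two_cases ξ₁ with rfl | rfl <;> rcases zmod_two_cases ξ₂ with rfl | rfl <;>
  rcases zmod_two_cases u with rfl | rfl <;> rcases zmod_two_cases v with rfl | rfl <;>
  simp only [add_zero, zero_add, mul_zero, mul_one, h11, v0, v1, h01, h10,
    ne_eq, not_true_eq_false, not_false_eq_true, forall_const, false_imp_iff, true_and,
    and_true] at hp hq hr hy ⊢ <;>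
  omega

lemma riemann_local (a b ξ : ZMod 2 × ZMod 2) (x : (ℤ × ℤ) × (ℤ × ℤ)) :
    ∑ c : ZMod 2 × ZMod 2, binSign (ξ.1 * c.2 + ξ.2 * c.1) * quadWeight a b c x =
      2 * binSign ((riemannShift a b).2 * ξ.1 + (riemannShift a b).1 * ξ.2) *
        quadWeight a b (ξ + riemannShift a b) (hadamard x) := by
  obtain ⟨⟨p, q⟩, r, s⟩ := x
  by_cases hev : (p + q + r + s) % 2 = 0
  swap
  · have hh : hadamard ((p, q), (r, s)) = ((p, q), (r, s)) := if_neg hev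
    rw [hh, quadWeight_eq_zero hev, mul_zero]
    exact Finset.sum_eq_zero fun c _ => by rw [quadWeight_eq_zero hev, mul_zero]
  obtain ⟨y, hy⟩ : ∃ y, p + q + r + s = 2 * y := Int.dvd_of_emod_eq_zero hev
  have hh : hadamard ((p, q), (r, s)) = ((y, p + q - y), (p + r - y, p + s - y)) := by
    rw [hadamard, if_pos hev]
    simp only [Prod.mk.injEq]
    omega
  rw [hh]
  have hflip : ∀ (t : ℤ) (z : ZMod 2),
      ((p + t - y : ℤ) : ZMod 2) = y + z ↔ (t : ZMod 2) = p + z := by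
    intro t z
    push_cast
    generalize (p : ZMod 2) = p
    generalize (t : ZMod 2) = t
    generalize (y : ZMod 2) = y
    revert p t y z
    decide
  by_cases hc : (q : ZMod 2) = p + a.1 ∧ (r : ZMod 2) = p + b.1 ∧ (s : ZMod 2) = p + a.1 + b.1
  swap
  · have hL : ∀ c, quadWeight a b c ((p, q), (r, s)) = 0 := by
      intro c
      by_contra h
      exact hc (quadWeight_ne_zero h)
    have hR : quadWeight a b (ξ + riemannShift a b)
        ((y, p + q - y), (p + r - y, p + s - y)) = 0 := by
      by_contra h
      obtain ⟨h1, h2, h3⟩ := quadWeight_ne_zero h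
      rw [add_assoc] at h3
      exact hc ⟨(hflip _ _).mp h1, (hflip _ _).mp h2, by rw [add_assoc, (hflip _ _).mp h3]⟩
    simp [hL, hR]
  obtain ⟨hq, hr, hs⟩ := hc
  have hs' : ((p + s - y : ℤ) : ZMod 2) = y + a.1 + b.1 := by
    rw [add_assoc] at hs ⊢
    exact (hflip _ _).mpr hs
  rw [quadWeight_eq_ite ((hflip _ _).mpr hq) ((hflip _ _).mpr hr) hs', Fintype.sum_prod_type]
  simp_rw [quadWeight_eq_ite hq hr hs]
  simp only [mul_ite, mul_zero]
  rw [Finset.sum_comm]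
  simp only [Finset.sum_ite_eq, Finset.mem_univ, if_true]
  obtain ⟨h1, h2⟩ := quadExp_emod_four a b ξ p y p q r s y (emod_two_eq_val rfl)
    (emod_two_eq_val hq) (emod_two_eq_val hr) hy (emod_two_eq_val rfl)
  have h01 : (Finset.univ : Finset (ZMod 2)) = {0, 1} := rfl
  simp only [binSign_eq_zpow, mul_assoc, ← zpow_add₀ Complex.I_ne_zero, h01,
    Finset.sum_pair zero_ne_one, Prod.fst_add, Prod.snd_add]
  split_ifs with hv
  · rw [I_zpow_congr (h1 hv 0), I_zpow_congr (h1 hv 1)]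
    ring
  · rw [I_zpow_congr_neg (h2 hv)]
    ring

/-! ### The Riemann relation -/

/-- The symplectic pairing on characteristics, as a sign. -/
def sympSign {ι : Type} [Fintype ι] (ξ c : Char2 ι) : ℂ :=
  ∏ j, binSign (ξ.1 j * c.2 j + ξ.2 j * c.1 j)

lemma sum_prod_char {ι : Type} [Fintype ι] [DecidableEq ι] (F : ι → ZMod 2 × ZMod 2 → ℂ) :
    ∑ c : Char2 ι, ∏ j, F j (c.1 j, c.2 j) = ∏ j, ∑ c, F j c := by
  rw [Finset.prod_univ_sum, Fintype.piFinset_univ]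
  exact Fintype.sum_equiv (Equiv.arrowProdEquivProdArrow ι (fun _ => ZMod 2) fun _ => ZMod 2).symm
    _ _ fun _ => rfl

/-- The product of the four theta constants on the affine plane through `c` with directions
`a` and `b`. -/
def quadTheta {ι : Type} [Fintype ι] (τ : Matrix ι ι ℂ) (a b c : Char2 ι) : ℂ :=
  (thetaConst c τ * thetaConst (c + a) τ) * (thetaConst (c + b) τ * thetaConst (c + a + b) τ)

/-- Quadruples of lattice points. -/
abbrev Quad (ι : Type) := ((ι → ℤ) × (ι → ℤ)) × ((ι → ℤ) × (ι → ℤ))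

/-- The `j`-th coordinates of a quadruple of lattice points. -/
def Quad.coord {ι : Type} (X : Quad ι) (j : ι) : (ℤ × ℤ) × (ℤ × ℤ) :=
  ((X.1.1 j, X.1.2 j), (X.2.1 j, X.2.2 j))

/-- The coordinatewise reflection on quadruples of lattice points. -/
def Quad.reflect {ι : Type} (X : Quad ι) : Quad ι :=
  ((fun j => (hadamard (X.coord j)).1.1, fun j => (hadamard (X.coord j)).1.2),
    (fun j => (hadamard (X.coord j)).2.1, fun j => (hadamard (X.coord j)).2.2))

lemma Quad.coord_reflect {ι : Type} (X : Quad ι) (j : ι) :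
    X.reflect.coord j = hadamard (X.coord j) := rfl

lemma Quad.reflect_involutive {ι : Type} : Function.Involutive (Quad.reflect (ι := ι)) := by
  intro X
  have h : ∀ j, X.reflect.reflect.coord j = X.coord j := fun j => by
    rw [Quad.coord_reflect, Quad.coord_reflect, hadamard_involutive]
  simp only [Quad.coord, Prod.mk.injEq] at h
  ext j
  · exact (h j).1.1
  · exact (h j).1.2
  · exact (h j).2.1
  · exact (h j).2.2

/-- The product of the four Gaussian factors of a quadruple. -/
def quadLattice {ι : Type} [Fintype ι] (τ : Matrix ι ι ℂ) (X : Quad ι) : ℂ :=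
  (latticeTerm τ X.1.1 * latticeTerm τ X.1.2) * (latticeTerm τ X.2.1 * latticeTerm τ X.2.2)

lemma quadLattice_reflect {ι : Type} [Fintype ι] (τ : Matrix ι ι ℂ) (X : Quad ι)
    (h : ∀ j, (X.1.1 j + X.1.2 j + X.2.1 j + X.2.2 j) % 2 = 0) :
    quadLattice τ X.reflect = quadLattice τ X := by
  simp only [quadLattice, latticeTerm, ← Complex.exp_add, ← mul_add, ← Finset.sum_add_distrib]
  congr 2
  refine Finset.sum_congr rfl fun i _ => Finset.sum_congr rfl fun j _ => ?_
  have hr : ∀ j, ∃ y : ℤ, X.1.1 j + X.1.2 j + X.2.1 j + X.2.2 j = 2 * y ∧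
      hadamard (X.coord j) =
        ((y, X.1.1 j + X.1.2 j - y), (X.1.1 j + X.2.1 j - y, X.1.1 j + X.2.2 j - y)) := by
    intro j
    obtain ⟨y, hy⟩ := Int.dvd_of_emod_eq_zero (h j)
    refine ⟨y, hy, ?_⟩
    refine (if_pos (h j)).trans ?_
    simp only [Quad.coord, Prod.mk.injEq]
    omega
  obtain ⟨y, hy, ey⟩ := hr i
  obtain ⟨z, hz, ez⟩ := hr j
  simp only [Quad.reflect, ey, ez]
  have hy' : X.2.2 i = 2 * y - X.1.1 i - X.1.2 i - X.2.1 i := by omega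
  have hz' : X.2.2 j = 2 * z - X.1.1 j - X.1.2 j - X.2.1 j := by omega
  rw [hy', hz']
  push_cast
  ring

/-- The summand of `quadTheta`. -/
def quadTerm {ι : Type} [Fintype ι] (τ : Matrix ι ι ℂ) (a b c : Char2 ι) (X : Quad ι) : ℂ :=
  (∏ j, quadWeight (a.1 j, a.2 j) (b.1 j, b.2 j) (c.1 j, c.2 j) (X.coord j)) * quadLattice τ X

lemma hasSum_quadTerm {g : ℕ} {τ : Matrix (Fin g) (Fin g) ℂ} (hτ : τ ∈ Siegel (Fin g))
    (a b c : Char2 (Fin g)) : HasSum (quadTerm τ a b c) (quadTheta τ a b c) := by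
  have hs := summable_norm_thetaTerm hτ
  have h2 := fun m n => (hs m).mul_norm (hs n)
  have h4 := summable_mul_of_summable_norm (h2 c (c + a)) (h2 (c + b) (c + a + b))
  have e : quadTheta τ a b c = ∑' X, quadTerm τ a b c X := by
    simp only [quadTheta, thetaConst_eq_tsum]
    rw [tsum_mul_tsum_of_summable_norm (hs _) (hs _), tsum_mul_tsum_of_summable_norm (hs _) (hs _),
      tsum_mul_tsum_of_summable_norm (h2 _ _) (h2 _ _)]
    refine tsum_congr fun X => ?_
    simp only [quadTerm, quadWeight, Quad.coord, quadLattice, Finset.prod_mul_distrib,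
      Prod.fst_add, Prod.snd_add, Pi.add_apply]
    ring
  rw [e]
  refine (h4.congr fun X => ?_).hasSum
  simp only [quadTerm, quadWeight, Quad.coord, quadLattice, Finset.prod_mul_distrib,
    Prod.fst_add, Prod.snd_add, Pi.add_apply]
  ring

/-- The coordinatewise shift of characteristics in the Riemann relation. -/
def charShift {ι : Type} (a b : Char2 ι) : Char2 ι :=
  (fun j => (riemannShift (a.1 j, a.2 j) (b.1 j, b.2 j)).1,
    fun j => (riemannShift (a.1 j, a.2 j) (b.1 j, b.2 j)).2)

lemma sum_sympSign_mul_quadTerm {ι : Type} [Fintype ι] [DecidableEq ι] (τ : Matrix ι ι ℂ) (a b ξ : Char2 ι)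
    (X : Quad ι) :
    ∑ c, sympSign ξ c * quadTerm τ a b c X =
      2 ^ Fintype.card ι * sympSign (charShift a b) ξ *
        quadTerm τ a b (ξ + charShift a b) X.reflect := by
  have h1 : ∑ c, sympSign ξ c * quadTerm τ a b c X =
      (∏ j, ∑ c : ZMod 2 × ZMod 2, binSign (ξ.1 j * c.2 + ξ.2 j * c.1) *
        quadWeight (a.1 j, a.2 j) (b.1 j, b.2 j) c (X.coord j)) * quadLattice τ X := by
    rw [← sum_prod_char fun j c => binSign (ξ.1 j * c.2 + ξ.2 j * c.1) *
      quadWeight (a.1 j, a.2 j) (b.1 j, b.2 j) c (X.coord j), Finset.sum_mul]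
    refine Finset.sum_congr rfl fun c _ => ?_
    rw [sympSign, quadTerm, Finset.prod_mul_distrib, mul_assoc]
  have h2 := fun j => riemann_local (a.1 j, a.2 j) (b.1 j, b.2 j) (ξ.1 j, ξ.2 j) (X.coord j)
  dsimp only at h2
  rw [h1]
  by_cases h : ∀ j, (X.1.1 j + X.1.2 j + X.2.1 j + X.2.2 j) % 2 = 0
  · simp only [h2, Finset.prod_mul_distrib, Finset.prod_const, Finset.card_univ]
    rw [quadTerm, quadLattice_reflect τ X h, ← mul_assoc]
    simp only [Quad.coord_reflect, sympSign]
    have e : ∀ j, (ξ.1 j, ξ.2 j) + riemannShift (a.1 j, a.2 j) (b.1 j, b.2 j) =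
      ((ξ + charShift a b).1 j, (ξ + charShift a b).2 j) := fun j => rfl
    simp only [e]
    congr 3
    refine Finset.prod_congr rfl fun j _ => ?_
    rw [add_comm]
    rfl
  · obtain ⟨j, hj⟩ := not_forall.mp h
    have hfix : hadamard (X.coord j) = X.coord j := if_neg hj
    rw [Finset.prod_eq_zero (Finset.mem_univ j), quadTerm,
      Finset.prod_eq_zero (Finset.mem_univ j)]
    · simp
    · rw [Quad.coord_reflect, hfix]
      exact quadWeight_eq_zero hj
    · exact Finset.sum_eq_zero fun c _ => by
        rw [quadWeight_eq_zero (x := X.coord j) hj, mul_zero]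

/-- Riemann's quartic relation: the product of four theta constants over an affine plane is
self-dual, up to a shift and a sign, for the symplectic Fourier transform. -/
theorem riemann_relation {g : ℕ} {τ : Matrix (Fin g) (Fin g) ℂ} (hτ : τ ∈ Siegel (Fin g))
    (a b ξ : Char2 (Fin g)) :
    ∑ c, sympSign ξ c * quadTheta τ a b c =
      2 ^ g * sympSign (charShift a b) ξ * quadTheta τ a b (ξ + charShift a b) := by
  have h1 : HasSum (fun X : Quad (Fin g) => ∑ c, sympSign ξ c * quadTerm τ a b c X)
      (∑ c, sympSign ξ c * quadTheta τ a b c) :=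
    hasSum_sum fun c _ => (hasSum_quadTerm hτ a b c).mul_left _
  have h2 : HasSum (fun X : Quad (Fin g) => 2 ^ g * sympSign (charShift a b) ξ *
        quadTerm τ a b (ξ + charShift a b) X.reflect)
      (2 ^ g * sympSign (charShift a b) ξ * quadTheta τ a b (ξ + charShift a b)) :=
    (((Quad.reflect_involutive.toPerm _).hasSum_iff).mpr
      (hasSum_quadTerm hτ a b (ξ + charShift a b))).mul_left _
  simp only [sum_sympSign_mul_quadTerm, Fintype.card_fin] at h1
  exact h1.unique h2

/-! ### Fourier analysis on characteristics -/

lemma binSign_add (x y : ZMod 2) : binSign (x + y) = binSign x * binSign y := by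
  have h11 : (1 + 1 : ZMod 2) = 0 := rfl
  rcases zmod_two_cases x with rfl | rfl <;> rcases zmod_two_cases y with rfl | rfl <;>
    simp [binSign, h11]

lemma sympSign_add {ι : Type} [Fintype ι] (ξ c d : Char2 ι) :
    sympSign ξ (c + d) = sympSign ξ c * sympSign ξ d := by
  simp only [sympSign, ← Finset.prod_mul_distrib, ← binSign_add]
  refine Finset.prod_congr rfl fun j _ => ?_
  congr 1
  simp only [Prod.fst_add, Prod.snd_add, Pi.add_apply]
  ring

lemma sympSign_pow_four {ι : Type} [Fintype ι] (ξ c : Char2 ι) : sympSign ξ c ^ 4 = 1 := by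
  rw [sympSign, ← Finset.prod_pow]
  refine Finset.prod_eq_one fun j _ => ?_
  unfold binSign
  split_ifs <;> norm_num

lemma sum_sympSign {ι : Type} [Fintype ι] [DecidableEq ι] (c : Char2 ι) :
    ∑ ξ, sympSign ξ c = if c = 0 then 4 ^ Fintype.card ι else 0 := by
  have h1 := sum_prod_char fun (j : ι) (ξ : ZMod 2 × ZMod 2) =>
    binSign (ξ.1 * c.2 j + ξ.2 * c.1 j)
  have h2 : ∀ x y : ZMod 2, ∑ ξ : ZMod 2 × ZMod 2, binSign (ξ.1 * x + ξ.2 * y) =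
      if y = 0 ∧ x = 0 then 4 else 0 := by
    intro x y
    have h01 : (Finset.univ : Finset (ZMod 2)) = {0, 1} := rfl
    have h11 : (1 + 1 : ZMod 2) = 0 := rfl
    rw [Fintype.sum_prod_type]
    rcases zmod_two_cases x with rfl | rfl <;> rcases zmod_two_cases y with rfl | rfl <;>
      simp [binSign, h01, h11]
    all_goals norm_num
  simp only [h2] at h1
  refine Eq.trans h1 ?_
  split_ifs with hc
  · simp [hc]
  · obtain ⟨j, hj⟩ : ∃ j, ¬ (c.1 j = 0 ∧ c.2 j = 0) := by
      by_contra h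
      push Not at h
      exact hc (Prod.ext (funext fun j => (h j).1) (funext fun j => (h j).2))
    exact Finset.prod_eq_zero (Finset.mem_univ j) (if_neg hj)

lemma char2_add_self {ι : Type} (c : Char2 ι) : c + c = 0 := by
  ext j <;> exact CharTwo.add_self_eq_zero _

lemma sum_fourier_pow_four {ι : Type} [Fintype ι] [DecidableEq ι] (P : Char2 ι → ℂ) :
    ∑ ξ, (∑ c, sympSign ξ c * P c) ^ 4 =
      4 ^ Fintype.card ι * ∑ c, ∑ d, ∑ m, P m * P (m + c) * (P (m + d) * P (m + c + d)) := by
  have hR : ∑ c, ∑ d, ∑ m, P m * P (m + c) * (P (m + d) * P (m + c + d)) =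
      ∑ m, ∑ x, ∑ y, P m * P x * (P y * P (m + x + y)) := by
    have h1 : ∀ c, ∑ d, ∑ m, P m * P (m + c) * (P (m + d) * P (m + c + d)) =
        ∑ m, ∑ d, P m * P (m + c) * (P (m + d) * P (m + c + d)) := fun c => Finset.sum_comm
    simp only [h1]
    rw [Finset.sum_comm]
    refine Finset.sum_congr rfl fun m _ => ?_
    refine Fintype.sum_equiv (Equiv.addLeft m) _ _ fun c => ?_
    refine Fintype.sum_equiv (Equiv.addLeft m) _ _ fun d => ?_
    have e : m + (m + c) + (m + d) = m + c + d := by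
      have := char2_add_self m
      calc m + (m + c) + (m + d) = (m + m) + (m + c + d) := by abel
        _ = m + c + d := by rw [this, zero_add]
    simp only [Equiv.coe_addLeft, e]
  have hL : ∀ ξ, (∑ c, sympSign ξ c * P c) ^ 4 =
      ∑ m, ∑ x, ∑ y, ∑ z, P m * P x * (P y * P z) * sympSign ξ (m + x + y + z) := by
    intro ξ
    rw [show (4 : ℕ) = 2 * 2 from rfl, pow_mul, sq, sq, Finset.sum_mul_sum, Finset.sum_mul]
    refine Finset.sum_congr rfl fun m _ => ?_
    rw [Finset.sum_mul]
    refine Finset.sum_congr rfl fun x _ => ?_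
    rw [Finset.mul_sum]
    refine Finset.sum_congr rfl fun y _ => ?_
    rw [Finset.mul_sum]
    refine Finset.sum_congr rfl fun z _ => ?_
    simp only [sympSign_add]
    ring
  have hz : ∀ m x y z : Char2 ι, m + x + y + z = 0 ↔ m + x + y = z := by
    intro m x y z
    rw [add_eq_zero_iff_eq_neg, neg_eq_of_add_eq_zero_right (char2_add_self z)]
  simp only [hL]
  rw [hR, Finset.sum_comm, Finset.mul_sum]
  refine Finset.sum_congr rfl fun m _ => ?_
  rw [Finset.sum_comm, Finset.mul_sum]
  refine Finset.sum_congr rfl fun x _ => ?_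
  rw [Finset.sum_comm, Finset.mul_sum]
  refine Finset.sum_congr rfl fun y _ => ?_
  rw [Finset.sum_comm]
  simp only [← Finset.mul_sum, sum_sympSign, hz, mul_ite, mul_zero, Finset.sum_ite_eq,
    Finset.mem_univ, if_true]
  ring

theorem sum_quadTheta_mul {g : ℕ} {τ : Matrix (Fin g) (Fin g) ℂ} (hτ : τ ∈ Siegel (Fin g))
    (a b : Char2 (Fin g)) :
    ∑ c, ∑ d, ∑ m, quadTheta τ a b m * quadTheta τ a b (m + c) *
        (quadTheta τ a b (m + d) * quadTheta τ a b (m + c + d)) =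
      4 ^ g * ∑ m, quadTheta τ a b m ^ 4 := by
  have h := sum_fourier_pow_four (quadTheta τ a b)
  simp only [riemann_relation hτ, Fintype.card_fin, mul_pow, sympSign_pow_four, mul_one] at h
  have hshift : ∑ m, quadTheta τ a b (m + charShift a b) ^ 4 = ∑ m, quadTheta τ a b m ^ 4 :=
    Fintype.sum_equiv (Equiv.addRight (charShift a b)) _ _ fun _ => rfl
  rw [← Finset.mul_sum, hshift] at h
  have h4 : ((2 : ℂ) ^ g) ^ 4 = 4 ^ g * 4 ^ g := by
    rw [← pow_mul, ← mul_pow, mul_comm, pow_mul]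
    norm_num
  rw [h4, mul_assoc] at h
  exact (mul_left_cancel₀ (pow_ne_zero _ (by norm_num)) h).symm

/-! ### Sums over affine subspaces -/

section Flats

variable {V : Type*} [AddCommGroup V] [Module (ZMod 2) V]

/-- The point of the affine subspace through `x` directed by `v` with coordinates `t`. -/
def flatPoint {k : ℕ} (v : Fin k → V) (x : V) (t : Fin k → ZMod 2) : V :=
  x + ∑ i, t i • v i

/-- The product of `f` over the affine subspace through `x` directed by `v`. -/
def flatProd (f : V → ℂ) {k : ℕ} (v : Fin k → V) (x : V) : ℂ :=
  ∏ t, f (flatPoint v x t)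

lemma flatProd_zero (f : V → ℂ) (v : Fin 0 → V) (x : V) : flatProd f v x = f x := by
  simp [flatProd, flatPoint]

lemma flatProd_snoc (f : V → ℂ) {k : ℕ} (v : Fin k → V) (c x : V) :
    flatProd f (Fin.snoc v c : Fin (k + 1) → V) x = flatProd f v x * flatProd f v (x + c) := by
  have h01 : (Finset.univ : Finset (ZMod 2)) = {0, 1} := rfl
  rw [flatProd, ← (Fin.snocEquiv fun _ => ZMod 2).prod_comp, Fintype.prod_prod_type, h01,
    Finset.prod_pair zero_ne_one]
  simp only [flatProd, flatPoint, Fin.snocEquiv, Equiv.coe_fn_mk, Fin.sum_univ_castSucc,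
    Fin.snoc_castSucc, Fin.snoc_last, zero_smul, one_smul, add_zero]
  congr 1
  refine Finset.prod_congr rfl fun t _ => ?_
  congr 1
  abel

lemma flatProd_add_of_mem_span (f : V → ℂ) {k : ℕ} (v : Fin k → V) {c : V} (x : V)
    (hc : c ∈ Submodule.span (ZMod 2) (Set.range v)) : flatProd f v (x + c) = flatProd f v x := by
  obtain ⟨s, rfl⟩ := (Submodule.mem_span_range_iff_exists_fun _).mp hc
  refine Fintype.prod_equiv (Equiv.addLeft s) _ _ fun t => ?_
  simp only [flatPoint, Equiv.coe_addLeft, Pi.add_apply, add_smul, Finset.sum_add_distrib,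
    add_assoc]

lemma flatPoint_injective {k : ℕ} {v : Fin k → V} (hv : LinearIndependent (ZMod 2) v) (x : V) :
    Function.Injective (flatPoint v x) := by
  intro s t h
  have h1 : ∑ i, s i • v i = ∑ i, t i • v i := add_left_cancel h
  have h2 : ∑ i, (s i - t i) • v i = 0 := by
    simp only [sub_smul, Finset.sum_sub_distrib, h1, sub_self]
  funext i
  exact sub_eq_zero.mp (Fintype.linearIndependent_iff.mp hv (fun i => s i - t i) h2 i)

open Classical in
/-- The affine subspace through `x` directed by `v`. -/
def flat {k : ℕ} (v : Fin k → V) (x : V) : Finset V :=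
  Finset.univ.image (flatPoint v x)

lemma flatProd_eq_prod_flat (f : V → ℂ) {k : ℕ} {v : Fin k → V}
    (hv : LinearIndependent (ZMod 2) v) (x : V) : flatProd f v x = ∏ w ∈ flat v x, f w := by
  classical
  rw [flat, Finset.prod_image fun s _ t _ h => flatPoint_injective hv x h]
  rfl

lemma coe_flat {k : ℕ} (v : Fin k → V) (x : V) :
    (flat v x : Set V) = (fun u => x + u) '' (Submodule.span (ZMod 2) (Set.range v) : Set V) := by
  ext y
  simp only [flat, Finset.coe_image, Finset.coe_univ, Set.image_univ, Set.mem_range, Set.mem_image,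
    SetLike.mem_coe, Submodule.mem_span_range_iff_exists_fun, flatPoint]
  constructor
  · rintro ⟨t, rfl⟩
    exact ⟨_, ⟨t, rfl⟩, rfl⟩
  · rintro ⟨_, ⟨t, rfl⟩, rfl⟩
    exact ⟨t, rfl⟩

lemma mem_span_range_snoc {k : ℕ} (v : Fin k → V) (c d : V) :
    d ∈ Submodule.span (ZMod 2) (Set.range (Fin.snoc v c : Fin (k + 1) → V)) ↔
      d ∈ Submodule.span (ZMod 2) (Set.range v) ∨
        d - c ∈ Submodule.span (ZMod 2) (Set.range v) := by
  rw [Fin.range_snoc, Submodule.mem_span_insert]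
  constructor
  · rintro ⟨t, z, hz, rfl⟩
    rcases zmod_two_cases t with rfl | rfl
    · left
      simpa using hz
    · right
      simpa using hz
  · rintro (h | h)
    · exact ⟨0, d, h, by simp⟩
    · exact ⟨1, d - c, h, by simp⟩

variable [Fintype V]

lemma flat_eq_iff {k : ℕ} {v : Fin k → V} (hv : LinearIndependent (ZMod 2) v) (x : V)
    {U : Submodule (ZMod 2) V} (hU : Module.finrank (ZMod 2) U = k) {x₀ : V} {W : Finset V}
    (hW : (W : Set V) = (fun u => x₀ + u) '' (U : Set V)) :
    flat v x = W ↔ (∀ i, v i ∈ U) ∧ x ∈ W := by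
  have hmem : ∀ y, y ∈ W ↔ y - x₀ ∈ U := by
    intro y
    rw [← Finset.mem_coe, hW]
    constructor
    · rintro ⟨u, hu, rfl⟩
      simpa using hu
    · intro h
      exact ⟨y - x₀, h, by simp⟩
  have hflat : ∀ y, y ∈ flat v x ↔ y - x ∈ Submodule.span (ZMod 2) (Set.range v) := by
    intro y
    rw [← Finset.mem_coe, coe_flat]
    constructor
    · rintro ⟨u, hu, rfl⟩
      simpa using hu
    · intro h
      exact ⟨y - x, h, by simp⟩
  constructor
  · rintro rfl
    have hx : x ∈ flat v x := by simp [hflat]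
    refine ⟨fun i => ?_, hx⟩
    have h1 : x + v i ∈ flat v x := by
      rw [hflat, add_sub_cancel_left]
      exact Submodule.subset_span ⟨i, rfl⟩
    have := U.sub_mem ((hmem _).mp h1) ((hmem _).mp hx)
    simpa using this
  · rintro ⟨hvU, hx⟩
    have hspan : Submodule.span (ZMod 2) (Set.range v) = U := by
      apply Submodule.eq_of_le_of_finrank_eq
      · rw [Submodule.span_le]
        rintro _ ⟨i, rfl⟩
        exact hvU i
      · rw [finrank_span_eq_card hv, hU, Fintype.card_fin]
    ext y
    rw [hflat, hmem, hspan]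
    have hx' := (hmem x).mp hx
    constructor
    · intro h
      simpa using U.add_mem h hx'
    · intro h
      simpa using U.sub_mem h hx'

open Classical in
lemma card_filter_linearIndependent (U : Submodule (ZMod 2) V) {k : ℕ}
    (hU : Module.finrank (ZMod 2) U = k) :
    (Finset.univ.filter fun v : Fin k → V => LinearIndependent (ZMod 2) v ∧ ∀ i, v i ∈ U).card =
      ∏ i : Fin k, (2 ^ k - 2 ^ (i : ℕ)) := by
  have h := card_linearIndependent (K := ZMod 2) (V := U) (k := k) hU.ge
  rw [hU, ZMod.card] at h
  rw [← h, Nat.card_eq_fintype_card, Fintype.card_subtype]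
  symm
  refine Finset.card_bij (fun s _ i => (s i : V)) ?_ ?_ ?_
  · intro s hs
    simp only [Finset.mem_filter, Finset.mem_univ, true_and] at hs ⊢
    exact ⟨hs.map' U.subtype (Submodule.ker_subtype U), fun i => (s i).2⟩
  · intro s _ t _ hst
    funext i
    exact Subtype.ext (congrFun hst i)
  · intro v hv
    simp only [Finset.mem_filter, Finset.mem_univ, true_and] at hv
    refine ⟨fun i => ⟨v i, hv.2 i⟩, ?_, rfl⟩
    simp only [Finset.mem_filter, Finset.mem_univ, true_and]
    exact LinearIndependent.of_comp U.subtype hv.1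

open Classical in
lemma sum_flat_eq (F : Finset V → ℂ) (k : ℕ) :
    ∑ v : Fin k → V with LinearIndependent (ZMod 2) v, ∑ x, F (flat v x) =
      (((∏ i : Fin k, (2 ^ k - 2 ^ (i : ℕ))) * 2 ^ k : ℕ) : ℂ) *
        ∑ W ∈ Finset.univ.filter fun W : Finset V => ∃ (U : Submodule (ZMod 2) V) (x : V),
          Module.finrank (ZMod 2) U = k ∧ (W : Set V) = (fun u => x + u) '' (U : Set V), F W := by
  rw [← Finset.sum_product', Finset.mul_sum]
  rw [← Finset.sum_fiberwise_of_maps_to (f := fun p : (Fin k → V) × V => F (flat p.1 p.2))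
    (g := fun p : (Fin k → V) × V => flat p.1 p.2)
    (t := Finset.univ.filter fun W : Finset V => ∃ (U : Submodule (ZMod 2) V) (x : V),
      Module.finrank (ZMod 2) U = k ∧ (W : Set V) = (fun u => x + u) '' (U : Set V))]
  · refine Finset.sum_congr rfl fun W hW => ?_
    obtain ⟨U, x₀, hU, hWU⟩ := (Finset.mem_filter.mp hW).2
    rw [Finset.sum_congr rfl (g := fun _ => F W) fun p hp => by rw [(Finset.mem_filter.mp hp).2],
      Finset.sum_const, nsmul_eq_mul]
    congr 2
    have hset : (((Finset.univ.filter fun v : Fin k → V => LinearIndependent (ZMod 2) v) ×ˢ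
        (Finset.univ : Finset V)).filter fun p => flat p.1 p.2 = W) =
        (Finset.univ.filter fun v : Fin k → V => LinearIndependent (ZMod 2) v ∧ ∀ i, v i ∈ U) ×ˢ
          W := by
      ext ⟨v, x⟩
      simp only [Finset.mem_filter, Finset.mem_product, Finset.mem_univ, true_and, and_true]
      constructor
      · rintro ⟨hv, h⟩
        obtain ⟨h1, h2⟩ := (flat_eq_iff hv x hU hWU).mp h
        exact ⟨⟨hv, h1⟩, h2⟩
      · rintro ⟨⟨hv, h1⟩, h2⟩
        exact ⟨hv, (flat_eq_iff hv x hU hWU).mpr ⟨h1, h2⟩⟩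
    have hcard : W.card = 2 ^ k := by
      rw [← Set.ncard_coe_finset, hWU, Set.ncard_image_of_injective _ (add_right_injective x₀),
        ← Nat.card_coe_set_eq]
      have := Module.natCard_eq_pow_finrank (K := ZMod 2) (V := U)
      rw [hU, Nat.card_zmod] at this
      exact this
    rw [hset, Finset.card_product, card_filter_linearIndependent U hU, hcard]
  · intro p hp
    have hv := (Finset.mem_filter.mp (Finset.mem_product.mp hp).1).2
    refine Finset.mem_filter.mpr ⟨Finset.mem_univ _, _, p.2, ?_, coe_flat _ _⟩
    rw [finrank_span_eq_card hv, Fintype.card_fin]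

open Classical in
lemma sum_linearIndependent_succ {k : ℕ} (F : (Fin (k + 1) → V) → ℂ) :
    ∑ v : Fin (k + 1) → V with LinearIndependent (ZMod 2) v, F v =
      ∑ v : Fin k → V with LinearIndependent (ZMod 2) v,
        ∑ c : V with c ∉ Submodule.span (ZMod 2) (Set.range v), F (Fin.snoc v c) := by
  simp only [Finset.sum_filter]
  rw [← (Fin.snocEquiv fun _ => V).sum_comp, Fintype.sum_prod_type, Finset.sum_comm]
  refine Finset.sum_congr rfl fun v _ => ?_
  by_cases hv : LinearIndependent (ZMod 2) v
  · simp only [Fin.snocEquiv, Equiv.coe_fn_mk, linearIndependent_finSnoc, hv, true_and, if_true]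
  · simp only [Fin.snocEquiv, Equiv.coe_fn_mk, linearIndependent_finSnoc, hv, false_and, if_false,
      Finset.sum_const_zero]

open Classical in
/-- Splitting a sum over parallelograms of translates of a subgroup `L` of order four according
to the rank of the parallelogram modulo `L`. -/
lemma sum_parallelogram (P : V → ℂ) (L : Submodule (ZMod 2) V)
    (hL : (Finset.univ.filter fun c : V => c ∈ L).card = 4)
    (hP : ∀ x, ∀ c ∈ L, P (x + c) = P x) :
    ∑ c, ∑ d, ∑ m, P m * P (m + c) * (P (m + d) * P (m + c + d)) =
      16 * ∑ m, P m ^ 4 + 12 * ∑ c with c ∉ L, ∑ m, (P m * P (m + c)) ^ 2 +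
        ∑ c with c ∉ L, ∑ d with ¬ (d ∈ L ∨ d - c ∈ L),
          ∑ m, P m * P (m + c) * (P (m + d) * P (m + c + d)) := by
  have hsplit : ∀ h : V → ℂ, ∑ c, h c = ∑ c with c ∈ L, h c + ∑ c with c ∉ L, h c := fun h =>
    (Finset.sum_filter_add_sum_filter_not _ _ _).symm
  have hin : ∀ c ∈ L, ∑ d, ∑ m, P m * P (m + c) * (P (m + d) * P (m + c + d)) =
      4 * ∑ m, P m ^ 4 + ∑ d with d ∉ L, ∑ m, (P m * P (m + d)) ^ 2 := by
    intro c hc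
    have hterm : ∀ m d, P m * P (m + c) * (P (m + d) * P (m + c + d)) = (P m * P (m + d)) ^ 2 := by
      intro m d
      rw [hP m c hc, add_right_comm, hP _ c hc]
      ring
    simp only [hterm]
    rw [hsplit]
    congr 1
    rw [Finset.sum_congr rfl (g := fun _ => ∑ m, P m ^ 4), Finset.sum_const, hL, nsmul_eq_mul,
      Nat.cast_ofNat]
    intro d hd
    refine Finset.sum_congr rfl fun m _ => ?_
    rw [hP m d (Finset.mem_filter.mp hd).2]
    ring
  have hout : ∀ c ∉ L, ∑ d, ∑ m, P m * P (m + c) * (P (m + d) * P (m + c + d)) =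
      8 * ∑ m, (P m * P (m + c)) ^ 2 + ∑ d with ¬ (d ∈ L ∨ d - c ∈ L),
          ∑ m, P m * P (m + c) * (P (m + d) * P (m + c + d)) := by
    intro c hc
    have htwo : c + c = 0 := by
      rw [← two_smul (ZMod 2) c, show (2 : ZMod 2) = 0 from rfl, zero_smul]
    have hcard : (Finset.univ.filter fun d : V => d ∈ L ∨ d - c ∈ L).card = 8 := by
      rw [Finset.filter_or, Finset.card_union_of_disjoint, hL]
      · have : (Finset.univ.filter fun d : V => d - c ∈ L) =
            (Finset.univ.filter fun d : V => d ∈ L).map (Equiv.addRight c).toEmbedding := by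
          ext d
          simp [sub_eq_add_neg]
        rw [this, Finset.card_map, hL]
      · rw [Finset.disjoint_filter]
        intro d _ h1 h2
        exact hc (by simpa using L.sub_mem h1 h2)
    rw [← Finset.sum_filter_add_sum_filter_not _ fun d => d ∈ L ∨ d - c ∈ L]
    congr 1
    rw [Finset.sum_congr rfl (g := fun _ => ∑ m, (P m * P (m + c)) ^ 2), Finset.sum_const, hcard,
      nsmul_eq_mul, Nat.cast_ofNat]
    intro d hd
    refine Finset.sum_congr rfl fun m _ => ?_
    rcases (Finset.mem_filter.mp hd).2 with h | h
    · rw [hP _ d h, hP _ d h]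
      ring
    · have e1 : m + d = m + c + (d - c) := by abel
      have e2 : m + c + d = m + (d - c) + (c + c) := by abel
      rw [e1, e2, htwo, add_zero, hP _ _ h, hP _ _ h]
      ring
  rw [hsplit, Finset.sum_congr rfl fun c hc => hin c (Finset.mem_filter.mp hc).2,
    Finset.sum_congr rfl fun c hc => hout c (Finset.mem_filter.mp hc).2, Finset.sum_const, hL,
    Finset.sum_add_distrib, ← Finset.mul_sum, nsmul_eq_mul]
  push_cast
  ring

open Classical in
lemma card_filter_mem_span {k : ℕ} {v : Fin k → V} (hv : LinearIndependent (ZMod 2) v) :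
    (Finset.univ.filter fun c : V => c ∈ Submodule.span (ZMod 2) (Set.range v)).card = 2 ^ k := by
  have := Module.natCard_eq_pow_finrank (K := ZMod 2) (V := Submodule.span (ZMod 2) (Set.range v))
  rw [finrank_span_eq_card hv, Nat.card_zmod, Fintype.card_fin] at this
  rw [← this, Nat.card_eq_fintype_card, Fintype.card_subtype]

open Classical in
/-- The sum of the parallelogram sums of all planes, in terms of independent tuples. -/
lemma sum_sum_parallelogram (f : V → ℂ) :
    ∑ v : Fin 2 → V with LinearIndependent (ZMod 2) v, ∑ c, ∑ d, ∑ m,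
        flatProd f v m * flatProd f v (m + c) *
          (flatProd f v (m + d) * flatProd f v (m + c + d)) =
      16 * (∑ v : Fin 2 → V with LinearIndependent (ZMod 2) v, ∑ m, flatProd f v m ^ 4) +
      12 * (∑ v : Fin 3 → V with LinearIndependent (ZMod 2) v, ∑ m, flatProd f v m ^ 2) +
      ∑ v : Fin 4 → V with LinearIndependent (ZMod 2) v, ∑ m, flatProd f v m ^ 1 := by
  rw [sum_linearIndependent_succ (k := 3), sum_linearIndependent_succ (k := 2),
    sum_linearIndependent_succ (k := 2), Finset.mul_sum, Finset.mul_sum,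
    ← Finset.sum_add_distrib, ← Finset.sum_add_distrib]
  refine Finset.sum_congr rfl fun v hv => ?_
  rw [sum_parallelogram (flatProd f v) (Submodule.span (ZMod 2) (Set.range v))
    (card_filter_mem_span (Finset.mem_filter.mp hv).2)
    fun x c hc => flatProd_add_of_mem_span f v x hc]
  simp only [flatProd_snoc, mem_span_range_snoc, pow_one]
  congr 1
  refine Finset.sum_congr rfl fun c _ => Finset.sum_congr rfl fun d _ =>
    Finset.sum_congr rfl fun m _ => ?_
  rw [add_right_comm m c d]

end Flats

lemma sum_flatProd_eq_Sform {ι : Type} [Fintype ι] [DecidableEq ι] (τ : Matrix ι ι ℂ) (k s : ℕ)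
    [DecidablePred fun v : Fin k → Char2 ι => LinearIndependent (ZMod 2) v] :
    ∑ v : Fin k → Char2 ι with LinearIndependent (ZMod 2) v,
        ∑ m, flatProd (fun w => thetaConst w τ) v m ^ s =
      (((∏ i : Fin k, (2 ^ k - 2 ^ (i : ℕ))) * 2 ^ k : ℕ) : ℂ) * Sform ι k s τ := by
  have h := sum_flat_eq (V := Char2 ι) (fun W => (∏ w ∈ W, thetaConst w τ) ^ s) k
  refine Eq.trans ?_ (h.trans ?_)
  · refine Finset.sum_congr (by congr!) fun v hv => Finset.sum_congr rfl fun m _ => ?_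
    rw [flatProd_eq_prod_flat _ (by simpa using hv)]
  · unfold Sform
    refine congrArg (_ * ·) ?_
    refine Finset.sum_congr ?_ fun _ _ => rfl
    ext W
    simp only [Finset.mem_filter]
    exact and_congr (by simp) Iff.rfl

lemma flatProd_two_eq_quadTheta {ι : Type} [Fintype ι] (τ : Matrix ι ι ℂ) (v : Fin 2 → Char2 ι)
    (m : Char2 ι) :
    flatProd (fun w => thetaConst w τ) v m = quadTheta τ (v 0) (v 1) m := by
  have e : v = (Fin.snoc (Fin.snoc (Fin.elim0 : Fin 0 → Char2 ι) (v 0) : Fin 1 → Char2 ι) (v 1) :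
      Fin 2 → Char2 ι) := by
    funext i
    fin_cases i <;> rfl
  rw [e, flatProd_snoc, flatProd_snoc, flatProd_snoc]
  simp only [flatProd_zero]
  rw [← e, quadTheta, add_right_comm m (v 0) (v 1)]

/-- Igusa's identity for the modular forms `S_{i,s}^g`. -/
theorem igusa_identity_5 (g : ℕ) (hg : 4 ≤ g)
    (τ : Matrix (Fin g) (Fin g) ℂ) (hτ : τ ∈ Siegel (Fin g)) :
    ((2 : ℂ) ^ (2 * g - 4) - 1) * Sform (Fin g) 2 4 τ =
      42 * Sform (Fin g) 3 2 τ + 840 * Sform (Fin g) 4 1 τ := by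
  classical
  have h := sum_sum_parallelogram fun w : Char2 (Fin g) => thetaConst w τ
  simp only [sum_flatProd_eq_Sform] at h
  have h2 : ∀ v : Fin 2 → Char2 (Fin g), ∑ c, ∑ d, ∑ m,
      flatProd (fun w => thetaConst w τ) v m * flatProd (fun w => thetaConst w τ) v (m + c) *
        (flatProd (fun w => thetaConst w τ) v (m + d) *
          flatProd (fun w => thetaConst w τ) v (m + c + d)) =
      4 ^ g * ∑ m, flatProd (fun w => thetaConst w τ) v m ^ 4 := by
    intro v
    simp only [flatProd_two_eq_quadTheta]
    exact sum_quadTheta_mul hτ (v 0) (v 1)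
  simp only [h2] at h
  rw [← Finset.mul_sum, sum_flatProd_eq_Sform] at h
  simp only [Fin.prod_univ_succ] at h
  norm_num at h
  have h4 : (4 : ℂ) ^ g = 16 * 2 ^ (2 * g - 4) := by
    rw [show (16 : ℂ) = 2 ^ 4 by norm_num, ← pow_add, show (4 : ℂ) = 2 ^ 2 by norm_num, ← pow_mul]
    congr 1
    omega
  rw [h4] at h
  linear_combination h / 384
end
end

section
/- For every integer g ≥ 1, every integer i with 0 ≤ i ≤ min(g,4), every γ = [[A,B],[C,D]] ∈ Γ_g(1,2) and every τ ∈ ℍ_g: P_{i,2^{4−i}}^g(γ∘τ) = det(Cτ+D)⁸·P_{i,2^{4−i}}^g(τ); that is, P_{i,2^{4−i}}^g is a modular form of weight 8 with respect to Γ_g(1,2). -/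
open scoped BigOperators

noncomputable section

/-- `W` is (the underlying finite set of) an `i`-dimensional linear subspace of `𝔽₂^{2g}`. -/
def IsLinearSubspaceDim {ι : Type} [Fintype ι] (i : ℕ) (W : Finset (Char2 ι)) : Prop :=
  ∃ V : Submodule (ZMod 2) (Char2 ι),
    Module.finrank (ZMod 2) V = i ∧ (W : Set (Char2 ι)) = (V : Set (Char2 ι))

/-- The modular form `P_{i,s}^g(τ) = Σ_V (Π_{v∈V} θ_v(τ))^s`, the sum over all
`i`-dimensional linear subspaces `V` of `𝔽₂^{2g}`. -/
noncomputable def Pform (ι : Type) [Fintype ι] (i s : ℕ) (τ : Matrix ι ι ℂ) : ℂ :=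
  letI := Classical.propDecidable
  ∑ W ∈ Finset.univ.filter (fun W : Finset (Char2 ι) => IsLinearSubspaceDim i W),
    (∏ w ∈ W, thetaConst w τ) ^ s

/-- The standard symplectic form `J`. -/
def symplJ (g : ℕ) : Matrix (Fin g ⊕ Fin g) (Fin g ⊕ Fin g) ℤ :=
  Matrix.fromBlocks 0 1 (-1) 0

/-- The block matrix `[[A,B],[C,D]]` is in `Sp(2g,ℤ)`. -/
def IsSymplectic {g : ℕ} (A B C D : Matrix (Fin g) (Fin g) ℤ) : Prop :=
  Matrix.fromBlocks A B C D * symplJ g * (Matrix.fromBlocks A B C D).transpose = symplJ g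

/-- The block matrix `[[A,B],[C,D]]` is in Igusa's subgroup `Γ_g(1,2) ⊂ Sp(2g,ℤ)`:
symplectic, with `diag(ABᵀ) ≡ diag(CDᵀ) ≡ 0 mod 2`. -/
def InGammaOneTwo {g : ℕ} (A B C D : Matrix (Fin g) (Fin g) ℤ) : Prop :=
  IsSymplectic A B C D ∧ (∀ i, (A * B.transpose) i i % 2 = 0) ∧ (∀ i, (C * D.transpose) i i % 2 = 0)

/-- The action `γ∘τ = (Aτ+B)(Cτ+D)⁻¹` of `Sp(2g,ℤ)` on the Siegel upper half-space. -/
noncomputable def symplAction {g : ℕ} (A B C D : Matrix (Fin g) (Fin g) ℤ)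
    (τ : Matrix (Fin g) (Fin g) ℂ) : Matrix (Fin g) (Fin g) ℂ :=
  (A.map (Int.cast : ℤ → ℂ) * τ + B.map (Int.cast : ℤ → ℂ)) *
    (C.map (Int.cast : ℤ → ℂ) * τ + D.map (Int.cast : ℤ → ℂ))⁻¹

section Generation

open Matrix

variable {g : ℕ}

/-- The translation `τ ↦ τ + S` as a symplectic matrix. -/
def spTranslation (S : Matrix (Fin g) (Fin g) ℤ) (hS : S.IsSymm) : symplecticGroup (Fin g) ℤ :=
  ⟨fromBlocks 1 S 0 1, SymplecticGroup.fromBlocks_mem_iff.2 (by simp [hS.eq])⟩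

/-- The substitution `τ ↦ U τ Uᵀ` as a symplectic matrix; here `V = U⁻¹`. -/
def spLevi (U V : Matrix (Fin g) (Fin g) ℤ) (h : V * U = 1) : symplecticGroup (Fin g) ℤ :=
  ⟨fromBlocks U 0 0 Vᵀ, SymplecticGroup.fromBlocks_mem_iff.2
    (by simp [← transpose_mul, h])⟩

/-- The projection onto the `j`-th coordinate. -/
def coordProj {R : Type*} [Zero R] [One R] (j : Fin g) : Matrix (Fin g) (Fin g) R :=
  diagonal (Pi.single j 1)

/-- The inversion in the `j`-th coordinate as a symplectic matrix. -/
def spInversion (j : Fin g) : symplecticGroup (Fin g) ℤ :=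
  ⟨fromBlocks (1 - coordProj j) (-coordProj j) (coordProj j) (1 - coordProj j),
    SymplecticGroup.fromBlocks_mem_iff.2 (by
      have h : (coordProj j : Matrix (Fin g) (Fin g) ℤ) * coordProj j = coordProj j := by
        ext a b
        by_cases hb : b = j <;> by_cases ha : a = b <;> simp [coordProj, diagonal_apply, ha, hb]
      have ht : (coordProj j : Matrix (Fin g) (Fin g) ℤ)ᵀ = coordProj j := by simp [coordProj]
      simp [ht, mul_sub, sub_mul, h])⟩

/-- A subgroup of the symplectic group containing the standard generators. -/
structure ContainsGenerators (H : Subgroup (symplecticGroup (Fin g) ℤ)) : Prop where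
  translation : ∀ S hS, spTranslation S hS ∈ H
  levi : ∀ U V h, spLevi U V h ∈ H
  inversion : ∀ j, spInversion j ∈ H

/-- A row vector vanishes in the coordinates `j ≥ k` of both halves. -/
def VanishesFrom (k : Fin g) (y : Fin g ⊕ Fin g → ℤ) : Prop :=
  ∀ j, k ≤ j → y (.inl j) = 0 ∧ y (.inr j) = 0

lemma vecMul_spTranslation (x : Fin g ⊕ Fin g → ℤ) (S : Matrix (Fin g) (Fin g) ℤ)
    (hS : S.IsSymm) :
    x ᵥ* (spTranslation S hS).1 =
      Sum.elim (x ∘ .inl) ((x ∘ .inl) ᵥ* S + x ∘ .inr) := by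
  simp [spTranslation, vecMul_fromBlocks]

lemma vecMul_spLevi (x : Fin g ⊕ Fin g → ℤ) (U V : Matrix (Fin g) (Fin g) ℤ) (h : V * U = 1) :
    x ᵥ* (spLevi U V h).1 = Sum.elim ((x ∘ .inl) ᵥ* U) ((x ∘ .inr) ᵥ* Vᵀ) := by
  simp [spLevi, vecMul_fromBlocks]

lemma vecMul_spInversion (x : Fin g ⊕ Fin g → ℤ) (j : Fin g) :
    x ᵥ* (spInversion j).1 =
      Sum.elim (Function.update (x ∘ .inl) j (x (.inr j)))
        (Function.update (x ∘ .inr) j (-x (.inl j))) := by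
  simp only [spInversion, vecMul_fromBlocks]
  congr 1 <;> ext k <;> by_cases hk : k = j
  all_goals simp [vecMul_sub, coordProj, vecMul_diagonal, hk]

variable {H : Subgroup (symplecticGroup (Fin g) ℤ)}

/-- The size of a row vector in the coordinates `j ≥ k`, which the reduction below decreases. -/
def rowSize (k : Fin g) (x : Fin g ⊕ Fin g → ℤ) : ℕ :=
  ∑ j, if k ≤ j then (if j = k then 1 else 2) * (2 * (x (.inl j)).natAbs + (x (.inr j)).natAbs)
    else 0

lemma exists_natAbs_add_mul_lt (a b : ℤ) (ha : a ≠ 0) (hab : a.natAbs ≤ b.natAbs) :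
    ∃ c : ℤ, (a * c + b).natAbs < b.natAbs := by
  rcases le_or_gt 0 a with h | h <;> rcases le_or_gt 0 b with h' | h'
  · exact ⟨-1, by omega⟩
  · exact ⟨1, by omega⟩
  · exact ⟨1, by omega⟩
  · exact ⟨-1, by omega⟩

lemma rowSize_inversion_lt (k j : Fin g) (hj : k ≤ j) (x : Fin g ⊕ Fin g → ℤ)
    (h : (x (.inr j)).natAbs < (x (.inl j)).natAbs) :
    rowSize k (x ᵥ* (spInversion j).1) < rowSize k x := by
  rw [vecMul_spInversion]
  refine Finset.sum_lt_sum (fun l _ => ?_) ⟨j, Finset.mem_univ _, ?_⟩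
  · by_cases hl : l = j
    · subst hl; simp only [hj, if_true, Sum.elim_inl, Sum.elim_inr, Function.update_self]
      exact Nat.mul_le_mul_left _ (by omega)
    · simp [hl]
  · simp only [hj, if_true, Sum.elim_inl, Sum.elim_inr, Function.update_self]
    exact Nat.mul_lt_mul_of_pos_left (by omega) (by split_ifs <;> norm_num)

lemma rowSize_translation_lt (k j : Fin g) (hj : k ≤ j) (x : Fin g ⊕ Fin g → ℤ) (c : ℤ)
    (h : (x (.inl j) * c + x (.inr j)).natAbs < (x (.inr j)).natAbs) :
    rowSize k (x ᵥ* (spTranslation (diagonal (Pi.single j c)) (isSymm_diagonal _)).1) <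
      rowSize k x := by
  rw [vecMul_spTranslation]
  refine Finset.sum_lt_sum (fun l _ => ?_) ⟨j, Finset.mem_univ _, ?_⟩
  · by_cases hl : l = j
    · subst hl; simp only [hj, if_true, Sum.elim_inl, Sum.elim_inr, Pi.add_apply,
        vecMul_diagonal, Pi.single_eq_same, Function.comp]
      exact Nat.mul_le_mul_left _ (by omega)
    · simp [hl, vecMul_diagonal]
  · simp only [hj, if_true, Sum.elim_inl, Sum.elim_inr, Pi.add_apply,
        vecMul_diagonal, Pi.single_eq_same, Function.comp]
    exact Nat.mul_lt_mul_of_pos_left (by omega) (by split_ifs <;> norm_num)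

lemma vanishesFrom_translation (k j : Fin g) (hj : k ≤ j) (y : Fin g ⊕ Fin g → ℤ) (c : ℤ)
    (hy : VanishesFrom k y) :
    y ᵥ* (spTranslation (diagonal (Pi.single j c)) (isSymm_diagonal _)).1 = y := by
  rw [vecMul_spTranslation]
  ext (l | l)
  · simp
  · by_cases hl : l = j
    · subst hl; simp [vecMul_diagonal, hy l hj]
    · simp [hl, vecMul_diagonal]

lemma vanishesFrom_inversion (k j : Fin g) (hj : k ≤ j) (y : Fin g ⊕ Fin g → ℤ)
    (hy : VanishesFrom k y) : y ᵥ* (spInversion j).1 = y := by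
  rw [vecMul_spInversion]
  ext (l | l) <;> by_cases hl : l = j
  · subst hl; simp [hy l hj]
  · simp [hl]
  · subst hl; simp [hy l hj]
  · simp [hl]

/-- The exchange of the coordinates `k` and `j`. -/
def spSwap (k j : Fin g) : symplecticGroup (Fin g) ℤ :=
  spLevi ((Equiv.swap k j).permMatrix ℤ) ((Equiv.swap k j).permMatrix ℤ)
    (by rw [← Matrix.permMatrix_mul]; simp)

lemma vecMul_spSwap (k j : Fin g) (x : Fin g ⊕ Fin g → ℤ) :
    x ᵥ* (spSwap k j).1 =
      Sum.elim (x ∘ .inl ∘ Equiv.swap k j) (x ∘ .inr ∘ Equiv.swap k j) := by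
  rw [spSwap, vecMul_spLevi]
  simp [Matrix.vecMul_permMatrix, Function.comp_assoc]

/-- Addition of `c` times the `j`-th coordinate to the `k`-th one in the second half. -/
def spShear (k j : Fin g) (hkj : k ≠ j) (c : ℤ) : symplecticGroup (Fin g) ℤ :=
  spLevi (transvection k j (-c)) (transvection k j c)
    (by rw [transvection_mul_transvection_same _ _ hkj]; simp)

lemma vecMul_spShear (k j : Fin g) (hkj : k ≠ j) (c : ℤ) (x : Fin g ⊕ Fin g → ℤ) :
    x ᵥ* (spShear k j hkj c).1 =
      Sum.elim (Function.update (x ∘ .inl) j (x (.inl j) - x (.inl k) * c))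
        (Function.update (x ∘ .inr) k (x (.inr j) * c + x (.inr k))) := by
  rw [spShear, vecMul_spLevi]
  have hs (v : Fin g → ℤ) (a b l : Fin g) (c : ℤ) :
      (v ᵥ* single a b c) l = if l = b then v a * c else 0 := by
    simp only [vecMul, dotProduct, single_apply]
    split_ifs with h
    · simp [h]
    · simp [Ne.symm h]
  congr 1
  · ext l
    by_cases hl : l = j
    · subst hl; simp [transvection, vecMul_add, hs]; ring
    · simp [transvection, vecMul_add, hs, hl]
  · ext l
    by_cases hl : l = k
    · subst hl; simp [transvection, vecMul_add, hs]; ring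
    · simp [transvection, vecMul_add, hs, hl]

lemma vanishesFrom_swap (k j : Fin g) (hj : k ≤ j) (y : Fin g ⊕ Fin g → ℤ)
    (hy : VanishesFrom k y) : y ᵥ* (spSwap k j).1 = y := by
  rw [vecMul_spSwap]
  ext (l | l) <;> by_cases hl : l = k <;> by_cases hl' : l = j
  all_goals simp_all [hy j hj, hy k le_rfl, Equiv.swap_apply_of_ne_of_ne]

lemma vanishesFrom_shear (k j : Fin g) (hkj : k ≠ j) (hj : k ≤ j) (c : ℤ)
    (y : Fin g ⊕ Fin g → ℤ) (hy : VanishesFrom k y) : y ᵥ* (spShear k j hkj c).1 = y := by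
  rw [vecMul_spShear]
  have h1 := hy j hj
  have h2 := hy k le_rfl
  ext (l | l)
  · by_cases hl : l = j
    · subst hl; simp [h1, h2]
    · simp [hl]
  · by_cases hl : l = k
    · subst hl; simp [h1, h2]
    · simp [hl]

lemma rowSize_eq_add (k j : Fin g) (hkj : k < j) (x : Fin g ⊕ Fin g → ℤ) :
    rowSize k x = (2 * (x (.inl k)).natAbs + (x (.inr k)).natAbs) +
      2 * (2 * (x (.inl j)).natAbs + (x (.inr j)).natAbs) +
      ∑ l ∈ (Finset.univ.erase k).erase j, if k ≤ l then
        2 * (2 * (x (.inl l)).natAbs + (x (.inr l)).natAbs) else 0 := by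
  rw [rowSize, ← Finset.add_sum_erase _ _ (Finset.mem_univ k),
    ← Finset.add_sum_erase _ _ (Finset.mem_erase.2 ⟨hkj.ne', Finset.mem_univ j⟩), ← add_assoc]
  congr 1
  · simp [hkj.le, hkj.ne']
  · refine Finset.sum_congr rfl fun l hl => ?_
    simp only [Finset.mem_erase] at hl
    simp [hl.2.1]

lemma rowSize_swap_lt (k j : Fin g) (hkj : k < j) (x : Fin g ⊕ Fin g → ℤ)
    (hk : x (.inl k) = 0) (hj : x (.inl j) = 0)
    (h : (x (.inr k)).natAbs < (x (.inr j)).natAbs) :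
    rowSize k (x ᵥ* (spSwap k j).1) < rowSize k x := by
  rw [vecMul_spSwap, rowSize_eq_add k j hkj, rowSize_eq_add k j hkj x]
  have : ∀ l ∈ (Finset.univ.erase k).erase j, Equiv.swap k j l = l := fun l hl => by
    simp only [Finset.mem_erase] at hl
    exact Equiv.swap_apply_of_ne_of_ne hl.2.1 hl.1
  refine (congrArg₂ (· + ·) rfl (Finset.sum_congr rfl fun l hl => ?_)).trans_lt
    (add_lt_add_left ?_ _)
  · simp only [Sum.elim_inl, Sum.elim_inr, Function.comp, this l hl]
  simp only [Sum.elim_inl, Sum.elim_inr, Function.comp, Equiv.swap_apply_left,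
    Equiv.swap_apply_right, hk, hj]
  simp only [Int.natAbs_zero]
  omega

lemma rowSize_shear_lt (k j : Fin g) (hkj : k < j) (c : ℤ) (x : Fin g ⊕ Fin g → ℤ)
    (hk : x (.inl k) = 0)
    (h : (x (.inr j) * c + x (.inr k)).natAbs < (x (.inr k)).natAbs) :
    rowSize k (x ᵥ* (spShear k j hkj.ne c).1) < rowSize k x := by
  rw [vecMul_spShear, rowSize_eq_add k j hkj, rowSize_eq_add k j hkj x]
  refine (congrArg₂ (· + ·) rfl (Finset.sum_congr rfl fun l hl => ?_)).trans_lt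
    (add_lt_add_left ?_ _)
  · simp only [Finset.mem_erase] at hl
    simp only [Sum.elim_inl, Sum.elim_inr, Function.update_of_ne hl.1,
      Function.update_of_ne hl.2.1, Function.comp]
  simp only [Sum.elim_inl, Sum.elim_inr, Function.comp, Function.update_self, hk,
    Function.update_of_ne hkj.ne, Function.update_of_ne hkj.ne', zero_mul, sub_zero]
  omega

/-- A row vector can be moved by the generators into a position where, among the coordinates
`j ≥ k`, only the `k`-th one of the second half is possibly nonzero. -/
lemma exists_reduced_row (hH : ContainsGenerators H) (k : Fin g) (x : Fin g ⊕ Fin g → ℤ) :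
    ∃ h ∈ H, (∀ y, VanishesFrom k y → y ᵥ* h.1 = y) ∧
      (∀ j, k ≤ j → (x ᵥ* h.1) (.inl j) = 0) ∧ ∀ j, k < j → (x ᵥ* h.1) (.inr j) = 0 := by
  induction hn : rowSize k x using Nat.strong_induction_on generalizing x with
  | _ n ih =>
  subst hn
  have step (h₀ : symplecticGroup (Fin g) ℤ) (hm : h₀ ∈ H)
      (hf : ∀ y, VanishesFrom k y → y ᵥ* h₀.1 = y)
      (hlt : rowSize k (x ᵥ* h₀.1) < rowSize k x) :
      ∃ h ∈ H, (∀ y, VanishesFrom k y → y ᵥ* h.1 = y) ∧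
        (∀ j, k ≤ j → (x ᵥ* h.1) (.inl j) = 0) ∧ ∀ j, k < j → (x ᵥ* h.1) (.inr j) = 0 := by
    obtain ⟨h, h1, h2, h3, h4⟩ := ih _ hlt _ rfl
    refine ⟨h₀ * h, H.mul_mem hm h1, fun y hy => ?_, ?_⟩
    · rw [Submonoid.coe_mul, ← vecMul_vecMul, hf y hy, h2 y hy]
    · rw [Submonoid.coe_mul, ← vecMul_vecMul]
      exact ⟨h3, h4⟩
  by_cases hc : ∃ j, k ≤ j ∧ x (.inl j) ≠ 0
  · obtain ⟨j, hj, hx⟩ := hc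
    rcases lt_or_ge (x (.inr j)).natAbs (x (.inl j)).natAbs with hlt | hle
    · exact step _ (hH.inversion j) (vanishesFrom_inversion k j hj)
        (rowSize_inversion_lt k j hj x hlt)
    · obtain ⟨c, hc⟩ := exists_natAbs_add_mul_lt _ _ hx hle
      exact step _ (hH.translation _ _) (fun y => vanishesFrom_translation k j hj y c)
        (rowSize_translation_lt k j hj x c hc)
  push Not at hc
  by_cases hd : ∃ j, k < j ∧ x (.inr j) ≠ 0
  · obtain ⟨j, hj, hx⟩ := hd
    rcases lt_or_ge (x (.inr k)).natAbs (x (.inr j)).natAbs with hlt | hle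
    · exact step _ (hH.levi _ _ _) (vanishesFrom_swap k j hj.le)
        (rowSize_swap_lt k j hj x (hc k le_rfl) (hc j hj.le) hlt)
    · obtain ⟨c, hc'⟩ := exists_natAbs_add_mul_lt _ _ hx hle
      exact step _ (hH.levi _ _ _) (vanishesFrom_shear k j hj.ne hj.le c)
        (rowSize_shear_lt k j hj c x (hc k le_rfl) hc')
  push Not at hd
  exact ⟨1, H.one_mem, fun y _ => by simp, by simpa using hc, by simpa using hd⟩

/-- The relations between the blocks of a symplectic matrix that express `γ J γᵀ = J`. -/
lemma symplectic_block_relations {R ι : Type*} [CommRing R] [Fintype ι] [DecidableEq ι]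
    {A B C D : Matrix ι ι R} (h : fromBlocks A B C D ∈ symplecticGroup ι R) :
    A * Bᵀ = B * Aᵀ ∧ C * Dᵀ = D * Cᵀ ∧ A * Dᵀ - B * Cᵀ = 1 := by
  have := SymplecticGroup.transpose_mem h
  rw [fromBlocks_transpose, SymplecticGroup.fromBlocks_mem_iff] at this
  simpa using this

/-- If the first `k` rows of the lower half of a symplectic matrix are supported in the first `k`
coordinates of the second half, then a further row which is supported there in the second half
and in the first `k` coordinates in the first half has zero first half. -/
lemma lowerLeft_row_eq_zero {A B C D : Matrix (Fin g) (Fin g) ℤ}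
    (h : fromBlocks A B C D ∈ symplecticGroup (Fin g) ℤ) (k : Fin g)
    (hC : ∀ r < k, C r = 0) (hD : ∀ r < k, ∀ j, k ≤ j → D r j = 0)
    (hk : ∀ j, k ≤ j → C k j = 0) : C k = 0 := by
  obtain ⟨-, h2, h3⟩ := symplectic_block_relations h
  let D' : Matrix (Fin g) (Fin g) ℤ := of fun r j => if r < k then D r j else if r = j then 1 else 0
  let A' : Matrix (Fin g) (Fin g) ℤ := of fun j s => if s < k then if j < k then A s j else 0
    else if j = s then 1 else 0
  have hDA : D' * A' = 1 := by
    ext r s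
    rw [mul_apply]
    by_cases hr : r < k
    · by_cases hs : s < k
      · have := congrFun (congrFun h3 s) r
        rw [Matrix.sub_apply, mul_apply, mul_apply] at this
        simp only [transpose_apply, hC r hr, Pi.zero_apply, mul_zero, Finset.sum_const_zero,
          sub_zero] at this
        rw [show (1 : Matrix (Fin g) (Fin g) ℤ) r s = (1 : Matrix (Fin g) (Fin g) ℤ) s r by
          simp [one_apply, eq_comm], ← this]
        refine Finset.sum_congr rfl fun j _ => ?_
        by_cases hj : j < k
        · simp [D', A', hr, hs, hj, mul_comm]
        · simp [D', A', hr, hs, hj, hD r hr j (not_lt.1 hj)]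
      · have hrs : r ≠ s := fun e => hs (e ▸ hr)
        simp [D', A', hr, hs, hrs, hD r hr s (not_lt.1 hs)]
    · by_cases hs : s < k
      · have hrs : r ≠ s := fun e => hr (e ▸ hs)
        rw [one_apply_ne hrs]
        refine Finset.sum_eq_zero fun x _ => ?_
        by_cases hx : r = x
        · subst hx; simp [A', hr, hs]
        · simp [D', hr, hx]
      · simp [D', A', hr, hs, one_apply]
  have hz : D' *ᵥ C k = 0 := by
    ext r
    simp only [mulVec, dotProduct]
    by_cases hr : r < k
    · have := congrFun (congrFun h2 r) k
      rw [mul_apply, mul_apply] at this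
      simp only [hC r hr, Pi.zero_apply, zero_mul, Finset.sum_const_zero, transpose_apply] at this
      simp [D', hr, ← this]
    · simp [D', hr, hk r (not_lt.1 hr)]
  have := congrArg (A' *ᵥ ·) hz
  simpa [mulVec_mulVec, mul_eq_one_comm.1 hDA] using this

lemma exists_lowerLeft_rows_eq_zero (hH : ContainsGenerators H)
    (γ : symplecticGroup (Fin g) ℤ) (k : ℕ) (hkg : k ≤ g) :
    ∃ h ∈ H, ∀ r : Fin g, r.1 < k → (∀ j, (γ * h).1 (.inr r) (.inl j) = 0) ∧
      ∀ j : Fin g, k ≤ j.1 → (γ * h).1 (.inr r) (.inr j) = 0 := by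
  induction k with
  | zero => exact ⟨1, H.one_mem, fun r hr => absurd hr (Nat.not_lt_zero _)⟩
  | succ k ih =>
    obtain ⟨h, hm, hz⟩ := ih (Nat.le_of_succ_le hkg)
    let κ : Fin g := ⟨k, hkg⟩
    obtain ⟨h', hm', hfix, hl, hr⟩ := exists_reduced_row hH κ ((γ * h).1 (.inr κ))
    have hrow (r) : (γ * (h * h')).1 (.inr r) = (γ * h).1 (.inr r) ᵥ* h'.1 := by
      rw [← mul_assoc, Submonoid.coe_mul, mul_apply_eq_vecMul]
    have hold (r : Fin g) (hrk : r < κ) :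
        (γ * (h * h')).1 (.inr r) = (γ * h).1 (.inr r) := by
      rw [hrow]
      exact hfix _ fun j hj => ⟨(hz r hrk).1 j, (hz r hrk).2 j hj⟩
    refine ⟨h * h', H.mul_mem hm hm', fun r hrk => ?_⟩
    rcases Nat.lt_succ_iff_lt_or_eq.1 hrk with hlt | heq
    · rw [hold r hlt]
      exact ⟨(hz r hlt).1, fun j hj => (hz r hlt).2 j (by omega)⟩
    · obtain rfl : r = κ := Fin.ext heq
      have hmem := (γ * (h * h')).2
      rw [← fromBlocks_toBlocks (γ * (h * h')).1] at hmem
      refine ⟨fun j => ?_, fun j hj => ?_⟩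
      · refine congrFun (lowerLeft_row_eq_zero hmem κ (fun r hr => ?_) (fun r hr j hj => ?_)
          fun j hj => ?_) j
        · ext j
          simp only [toBlocks₂₁, of_apply, hold r hr]
          exact (hz r hr).1 j
        · simp only [toBlocks₂₂, of_apply, hold r hr]
          exact (hz r hr).2 j hj
        · simp only [toBlocks₂₁, of_apply, hrow]
          exact hl j hj
      · rw [hrow]
        exact hr j hj

/-- Translations, the Levi subgroup `GL_g(ℤ)` and the coordinate inversions generate
`Sp(2g, ℤ)`. -/
theorem ContainsGenerators.mem (hH : ContainsGenerators H)
    (γ : symplecticGroup (Fin g) ℤ) : γ ∈ H := by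
  obtain ⟨h, hm, hz⟩ := exists_lowerLeft_rows_eq_zero hH γ g le_rfl
  rw [← Subgroup.mul_mem_cancel_right H hm]
  obtain ⟨M, hM⟩ : ∃ M, γ * h = M := ⟨_, rfl⟩
  rw [hM] at hz ⊢
  obtain ⟨M, hmem⟩ := M
  obtain ⟨A, B, C, D, rfl⟩ : ∃ A B C D, M = fromBlocks A B C D :=
    ⟨_, _, _, _, (fromBlocks_toBlocks M).symm⟩
  obtain rfl : C = 0 := by
    ext r j
    exact (hz r r.2).1 j
  have hmem' := hmem
  rw [SymplecticGroup.fromBlocks_mem_iff] at hmem'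
  obtain ⟨-, h2, h3⟩ := hmem'
  simp only [transpose_zero, zero_mul, sub_zero] at h3
  have h4 : D * Aᵀ = 1 := mul_eq_one_comm.1 h3
  have h5 : Dᵀ * A = 1 := by rw [← transpose_one, ← h3]; simp
  have hS : (B * Aᵀ).IsSymm := by
    have := (symplectic_block_relations hmem).1
    simp [IsSymm, this]
  have : (⟨fromBlocks A B 0 D, hmem⟩ : symplecticGroup (Fin g) ℤ) =
      spTranslation (B * Aᵀ) hS * spLevi A Dᵀ h5 := by
    apply Subtype.ext
    simp [spTranslation, spLevi, fromBlocks_multiply, Matrix.mul_assoc, h3]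
  rw [this]
  exact H.mul_mem (hH.translation _ _) (hH.levi _ _ _)

end Generation

section SiegelAction

open Matrix

variable {g : ℕ}

/-- The numerator `Aτ + B` of the action of the symplectic group. -/
def spNum (γ : symplecticGroup (Fin g) ℤ) (τ : Matrix (Fin g) (Fin g) ℂ) :
    Matrix (Fin g) (Fin g) ℂ :=
  γ.1.toBlocks₁₁.map (Int.cast : ℤ → ℂ) * τ + γ.1.toBlocks₁₂.map (Int.cast : ℤ → ℂ)

/-- The denominator `Cτ + D` of the action of the symplectic group. -/
def spDen (γ : symplecticGroup (Fin g) ℤ) (τ : Matrix (Fin g) (Fin g) ℂ) :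
    Matrix (Fin g) (Fin g) ℂ :=
  γ.1.toBlocks₂₁.map (Int.cast : ℤ → ℂ) * τ + γ.1.toBlocks₂₂.map (Int.cast : ℤ → ℂ)

/-- The action of the symplectic group on the Siegel upper half-space. -/
def spAct (γ : symplecticGroup (Fin g) ℤ) (τ : Matrix (Fin g) (Fin g) ℂ) :
    Matrix (Fin g) (Fin g) ℂ :=
  spNum γ τ * (spDen γ τ)⁻¹

lemma mem_siegel_iff {τ : Matrix (Fin g) (Fin g) ℂ} :
    τ ∈ Siegel (Fin g) ↔
      τ.IsSymm ∧ ∀ w : Fin g → ℂ, w ≠ 0 → 0 < (star w ⬝ᵥ τ *ᵥ w).im := by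
  have expand (w : Fin g → ℂ) : (star w ⬝ᵥ τ *ᵥ w).im =
      (∑ i, ∑ j, (w i).re * (τ i j).im * (w j).re) +
      (∑ i, ∑ j, (w i).im * (τ i j).im * (w j).im) +
      ((∑ i, ∑ j, (w i).re * (τ i j).re * (w j).im) -
      ∑ i, ∑ j, (w i).im * (τ i j).re * (w j).re) := by
    simp only [dotProduct, mulVec, Finset.mul_sum, Complex.im_sum, ← Finset.sum_add_distrib,
      ← Finset.sum_sub_distrib]
    refine Finset.sum_congr rfl fun i _ => Finset.sum_congr rfl fun j _ => ?_
    simp only [Pi.star_apply, RCLike.star_def, Complex.mul_im, Complex.mul_re, Complex.conj_re,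
      Complex.conj_im]
    ring
  refine and_congr_right fun hs => ⟨fun h w hw => ?_, fun h v hv => ?_⟩
  · have hcross : (∑ i, ∑ j, (w i).re * (τ i j).re * (w j).im) =
        ∑ i, ∑ j, (w i).im * (τ i j).re * (w j).re := by
      rw [Finset.sum_comm]
      refine Finset.sum_congr rfl fun i _ => Finset.sum_congr rfl fun j _ => ?_
      rw [hs.apply]
      ring
    rw [expand, hcross, sub_self, add_zero]
    have nonneg (v : Fin g → ℝ) : 0 ≤ ∑ i, ∑ j, v i * (τ i j).im * v j := by
      by_cases hv : v = 0
      · simp [hv]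
      · exact (h v hv).le
    by_cases hre : (fun i => (w i).re) = 0
    · have him : (fun i => (w i).im) ≠ 0 := fun him =>
        hw (funext fun i => Complex.ext (congrFun hre i) (congrFun him i))
      exact add_pos_of_nonneg_of_pos (nonneg _) (h _ him)
    · exact add_pos_of_pos_of_nonneg (h _ hre) (nonneg _)
  · have := h (fun i => (v i : ℂ)) fun e => hv (funext fun i => by simpa using congrFun e i)
    simpa [expand] using this

lemma spNum_spDen_relation (γ : symplecticGroup (Fin g) ℤ) (σ τ : Matrix (Fin g) (Fin g) ℂ) :
    (spDen γ σᵀ)ᵀ * spNum γ τ - (spNum γ σᵀ)ᵀ * spDen γ τ = τ - σ := by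
  have hmem := SymplecticGroup.map_mem γ.2 (Int.castRingHom ℂ)
  rw [← fromBlocks_toBlocks γ.1, fromBlocks_map, SymplecticGroup.fromBlocks_mem_iff] at hmem
  obtain ⟨h1, h2, h3⟩ := hmem
  simp only [spDen, spNum]
  simp only [Int.coe_castRingHom] at h1 h2 h3
  set A := γ.1.toBlocks₁₁.map (Int.cast : ℤ → ℂ)
  set B := γ.1.toBlocks₁₂.map (Int.cast : ℤ → ℂ)
  set C := γ.1.toBlocks₂₁.map (Int.cast : ℤ → ℂ)
  set D := γ.1.toBlocks₂₂.map (Int.cast : ℤ → ℂ)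
  have h4 : Dᵀ * A - Bᵀ * C = 1 := by
    rw [← transpose_one, ← h3]; simp
  simp only [transpose_add, transpose_mul, transpose_transpose]
  calc _ = σ * (Cᵀ * A - Aᵀ * C) * τ - σ * (Aᵀ * D - Cᵀ * B) + (Dᵀ * A - Bᵀ * C) * τ +
        (Dᵀ * B - Bᵀ * D) := by noncomm_ring
    _ = τ - σ := by rw [h1, h2, h3, h4]; noncomm_ring

lemma conjTranspose_spDen (γ : symplecticGroup (Fin g) ℤ) (τ : Matrix (Fin g) (Fin g) ℂ) :
    (spDen γ τ)ᴴ = (spDen γ (τᴴ)ᵀ)ᵀ := by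
  ext i j
  simp [spDen, mul_apply]

lemma conjTranspose_spNum (γ : symplecticGroup (Fin g) ℤ) (τ : Matrix (Fin g) (Fin g) ℂ) :
    (spNum γ τ)ᴴ = (spNum γ (τᴴ)ᵀ)ᵀ := by
  ext i j
  simp [spNum, mul_apply]

lemma im_star_dotProduct_mulVec (M : Matrix (Fin g) (Fin g) ℂ) (w : Fin g → ℂ) :
    star w ⬝ᵥ (M - Mᴴ) *ᵥ w = 2 * Complex.I * ((star w ⬝ᵥ M *ᵥ w).im : ℂ) := by
  have h : star w ⬝ᵥ Mᴴ *ᵥ w = star (star w ⬝ᵥ M *ᵥ w) := by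
    rw [star_dotProduct, star_mulVec, ← dotProduct_mulVec, conjTranspose_conjTranspose]
  rw [sub_mulVec, dotProduct_sub, h, RCLike.star_def, Complex.sub_conj]
  push_cast
  ring

lemma im_spDen_spNum (γ : symplecticGroup (Fin g) ℤ) (τ : Matrix (Fin g) (Fin g) ℂ)
    (w : Fin g → ℂ) :
    (star (spDen γ τ *ᵥ w) ⬝ᵥ spNum γ τ *ᵥ w).im = (star w ⬝ᵥ τ *ᵥ w).im := by
  have h := spNum_spDen_relation γ τᴴ τ
  rw [← conjTranspose_spDen, ← conjTranspose_spNum] at h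
  have h1 := im_star_dotProduct_mulVec ((spDen γ τ)ᴴ * spNum γ τ) w
  rw [conjTranspose_mul, conjTranspose_conjTranspose, h, im_star_dotProduct_mulVec,
    ← mulVec_mulVec, dotProduct_mulVec _ (spDen γ τ)ᴴ, ← star_mulVec] at h1
  exact_mod_cast (mul_left_cancel₀ (mul_ne_zero two_ne_zero Complex.I_ne_zero) h1).symm

lemma isUnit_det_spDen (γ : symplecticGroup (Fin g) ℤ) {τ : Matrix (Fin g) (Fin g) ℂ}
    (hτ : τ ∈ Siegel (Fin g)) : IsUnit (spDen γ τ).det := by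
  rw [isUnit_iff_ne_zero]
  intro h0
  obtain ⟨w, hw, hz⟩ := exists_mulVec_eq_zero_iff.2 h0
  have := (mem_siegel_iff.1 hτ).2 w hw
  rw [← im_spDen_spNum γ, hz] at this
  simp at this

lemma spAct_mul_spDen (γ : symplecticGroup (Fin g) ℤ) {τ : Matrix (Fin g) (Fin g) ℂ}
    (hτ : τ ∈ Siegel (Fin g)) : spAct γ τ * spDen γ τ = spNum γ τ := by
  rw [spAct, nonsing_inv_mul_cancel_right _ _ (isUnit_det_spDen γ hτ)]

lemma spAct_mem_siegel (γ : symplecticGroup (Fin g) ℤ) {τ : Matrix (Fin g) (Fin g) ℂ}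
    (hτ : τ ∈ Siegel (Fin g)) : spAct γ τ ∈ Siegel (Fin g) := by
  have hu := isUnit_det_spDen γ hτ
  have hs := (mem_siegel_iff.1 hτ).1
  refine mem_siegel_iff.2 ⟨?_, fun v hv => ?_⟩
  · have h := spNum_spDen_relation γ τ τ
    rw [hs.eq, sub_self, sub_eq_zero] at h
    have hut : IsUnit (spDen γ τ)ᵀ.det := by rwa [det_transpose]
    rw [IsSymm, spAct, transpose_mul, transpose_nonsing_inv]
    calc (spDen γ τ)ᵀ⁻¹ * (spNum γ τ)ᵀ
        = (spDen γ τ)ᵀ⁻¹ * ((spNum γ τ)ᵀ * spDen γ τ) * (spDen γ τ)⁻¹ := by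
          rw [Matrix.mul_assoc, mul_nonsing_inv_cancel_right _ _ hu]
      _ = spNum γ τ * (spDen γ τ)⁻¹ := by rw [← h, nonsing_inv_mul_cancel_left _ _ hut]
  · obtain ⟨w, rfl⟩ : ∃ w, v = spDen γ τ *ᵥ w :=
      ⟨(spDen γ τ)⁻¹ *ᵥ v, by rw [mulVec_mulVec, mul_nonsing_inv _ hu, one_mulVec]⟩
    rw [mulVec_mulVec, spAct_mul_spDen γ hτ, im_spDen_spNum]
    exact (mem_siegel_iff.1 hτ).2 w fun h => hv (by rw [h, mulVec_zero])

lemma spNum_mul (γ γ' : symplecticGroup (Fin g) ℤ) {τ : Matrix (Fin g) (Fin g) ℂ}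
    (hτ : τ ∈ Siegel (Fin g)) :
    spNum (γ * γ') τ = spNum γ (spAct γ' τ) * spDen γ' τ := by
  have h := spAct_mul_spDen γ' hτ
  have hA : (γ * γ').1.toBlocks₁₁ =
      γ.1.toBlocks₁₁ * γ'.1.toBlocks₁₁ + γ.1.toBlocks₁₂ * γ'.1.toBlocks₂₁ := by
    ext i j; simp [mul_apply, toBlocks₁₁, toBlocks₁₂, toBlocks₂₁]
  have hB : (γ * γ').1.toBlocks₁₂ =
      γ.1.toBlocks₁₁ * γ'.1.toBlocks₁₂ + γ.1.toBlocks₁₂ * γ'.1.toBlocks₂₂ := by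
    ext i j; simp [mul_apply, toBlocks₁₁, toBlocks₁₂, toBlocks₂₂]
  rw [spNum, spNum, add_mul, Matrix.mul_assoc, h, hA, hB]
  simp only [spNum, spDen, Matrix.map_add _ Int.cast_add, Matrix.map_mul_intCast]
  noncomm_ring

lemma spDen_mul (γ γ' : symplecticGroup (Fin g) ℤ) {τ : Matrix (Fin g) (Fin g) ℂ}
    (hτ : τ ∈ Siegel (Fin g)) :
    spDen (γ * γ') τ = spDen γ (spAct γ' τ) * spDen γ' τ := by
  have h := spAct_mul_spDen γ' hτ
  have hC : (γ * γ').1.toBlocks₂₁ =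
      γ.1.toBlocks₂₁ * γ'.1.toBlocks₁₁ + γ.1.toBlocks₂₂ * γ'.1.toBlocks₂₁ := by
    ext i j; simp [mul_apply, toBlocks₁₁, toBlocks₂₂, toBlocks₂₁]
  have hD : (γ * γ').1.toBlocks₂₂ =
      γ.1.toBlocks₂₁ * γ'.1.toBlocks₁₂ + γ.1.toBlocks₂₂ * γ'.1.toBlocks₂₂ := by
    ext i j; simp [mul_apply, toBlocks₂₁, toBlocks₁₂, toBlocks₂₂]
  rw [spDen, spDen, add_mul, Matrix.mul_assoc, h, hC, hD]
  simp only [spNum, spDen, Matrix.map_add _ Int.cast_add, Matrix.map_mul_intCast]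
  noncomm_ring

lemma spDen_one (τ : Matrix (Fin g) (Fin g) ℂ) : spDen 1 τ = 1 := by
  simp [spDen, ← fromBlocks_one]

lemma spAct_one (τ : Matrix (Fin g) (Fin g) ℂ) : spAct 1 τ = τ := by
  simp [spAct, spDen_one, spNum, ← fromBlocks_one]

lemma spAct_mul (γ γ' : symplecticGroup (Fin g) ℤ) {τ : Matrix (Fin g) (Fin g) ℂ}
    (hτ : τ ∈ Siegel (Fin g)) : spAct (γ * γ') τ = spAct γ (spAct γ' τ) := by
  rw [spAct, spNum_mul γ γ' hτ, spDen_mul γ γ' hτ, Matrix.mul_inv_rev, ← Matrix.mul_assoc,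
    mul_nonsing_inv_cancel_right _ _ (isUnit_det_spDen γ' hτ)]
  rfl

end SiegelAction

section Families

open Matrix

variable {g : ℕ}

/-- The sign `(-1)^z` of an element of `𝔽₂`. -/
def sgn2 (z : ZMod 2) : ℤ := 1 - 2 * (z.val : ℤ)

lemma sgn2_add (y z : ZMod 2) : sgn2 (y + z) = sgn2 y * sgn2 z := by
  revert y z; decide

/-- A family of vectors over `𝔽₂`, repeated `s` times, which has `16` members and all of whose
character sums are divisible by `16`. -/
def BalancedFamily {κ : Type} [Fintype κ] (s : ℕ) (v : κ → Fin g ⊕ Fin g → ZMod 2) : Prop :=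
  s * Fintype.card κ = 16 ∧ ∀ a, (16 : ℤ) ∣ s * ∑ k, sgn2 (a ⬝ᵥ v k)

/-- An affine image of a balanced family is balanced. -/
lemma BalancedFamily.affine {κ : Type} [Fintype κ] {s : ℕ} {v : κ → Fin g ⊕ Fin g → ZMod 2}
    (hv : BalancedFamily s v) (M : Matrix (Fin g ⊕ Fin g) (Fin g ⊕ Fin g) (ZMod 2))
    (t : Fin g ⊕ Fin g → ZMod 2) : BalancedFamily s (fun k => M *ᵥ v k + t) := by
  refine ⟨hv.1, fun a => ?_⟩
  have h : ∑ k, sgn2 (a ⬝ᵥ (M *ᵥ v k + t)) = (∑ k, sgn2 ((a ᵥ* M) ⬝ᵥ v k)) * sgn2 (a ⬝ᵥ t) := by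
    rw [Finset.sum_mul]
    simp only [dotProduct_add, dotProduct_mulVec, sgn2_add]
  rw [h, ← mul_assoc]
  exact (hv.2 _).mul_right _

/-- An integral function on `𝔽₂^{2g}` whose sums over balanced families are divisible by `8`. -/
def SumDivisible (q : (Fin g ⊕ Fin g → ZMod 2) → ℤ) : Prop :=
  ∀ (κ : Type) [Fintype κ] (s : ℕ) (v : κ → Fin g ⊕ Fin g → ZMod 2), BalancedFamily s v →
    (8 : ℤ) ∣ s * ∑ k, q (v k)

lemma SumDivisible.add {q r : (Fin g ⊕ Fin g → ZMod 2) → ℤ} (hq : SumDivisible q)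
    (hr : SumDivisible r) : SumDivisible fun x => q x + r x := fun κ _ s v hv => by
  rw [Finset.sum_add_distrib, mul_add]
  exact dvd_add (hq κ s v hv) (hr κ s v hv)

lemma SumDivisible.const_mul {q : (Fin g ⊕ Fin g → ZMod 2) → ℤ} (hq : SumDivisible q) (c : ℤ) :
    SumDivisible fun x => c * q x := fun κ _ s v hv => by
  rw [← Finset.mul_sum, mul_left_comm]
  exact (hq κ s v hv).mul_left c

lemma SumDivisible.sum {α : Type*} (S : Finset α) {q : α → (Fin g ⊕ Fin g → ZMod 2) → ℤ}
    (hq : ∀ a ∈ S, SumDivisible (q a)) : SumDivisible fun x => ∑ a ∈ S, q a x :=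
    fun κ _ s v hv => by
  rw [Finset.sum_comm, Finset.mul_sum]
  exact Finset.dvd_sum fun a ha => hq a ha κ s v hv

lemma sumDivisible_val (a : Fin g ⊕ Fin g → ZMod 2) :
    SumDivisible fun x => ((a ⬝ᵥ x).val : ℤ) := fun κ _ s v hv => by
  have h : 2 * (s * ∑ k, ((a ⬝ᵥ v k).val : ℤ)) =
      ((s * Fintype.card κ : ℕ) : ℤ) - s * ∑ k, sgn2 (a ⬝ᵥ v k) := by
    simp only [sgn2, Finset.sum_sub_distrib, ← Finset.mul_sum]
    simp only [Finset.sum_const, Finset.card_univ, nsmul_eq_mul]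
    push_cast
    ring
  have := hv.2 a
  rw [hv.1] at h
  beta_reduce
  omega

lemma sumDivisible_val_mul_val (a b : Fin g ⊕ Fin g → ZMod 2) :
    SumDivisible fun x => 2 * (((a ⬝ᵥ x).val : ℤ) * (b ⬝ᵥ x).val) := fun κ _ s v hv => by
  have key : ∀ y z : ZMod 2,
      4 * ((y.val : ℤ) * z.val) = 1 - sgn2 y - sgn2 z + sgn2 (y + z) := by decide
  have h : 2 * (s * ∑ k, 2 * (((a ⬝ᵥ v k).val : ℤ) * (b ⬝ᵥ v k).val)) =
      ((s * Fintype.card κ : ℕ) : ℤ) - s * ∑ k, sgn2 (a ⬝ᵥ v k) - s * ∑ k, sgn2 (b ⬝ᵥ v k) +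
        s * ∑ k, sgn2 ((a + b) ⬝ᵥ v k) := by
    have : ∑ k, 4 * (((a ⬝ᵥ v k).val : ℤ) * (b ⬝ᵥ v k).val) =
        Fintype.card κ - ∑ k, sgn2 (a ⬝ᵥ v k) - ∑ k, sgn2 (b ⬝ᵥ v k) +
        ∑ k, sgn2 ((a + b) ⬝ᵥ v k) := by
      simp only [key, Finset.sum_add_distrib, Finset.sum_sub_distrib, add_dotProduct]
      simp
    rw [← Finset.mul_sum] at this ⊢
    push_cast
    linear_combination (s : ℤ) * this
  have h1 := hv.2 a
  have h2 := hv.2 b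
  have h3 := hv.2 (a + b)
  rw [hv.1] at h
  beta_reduce
  omega

/-- The product of the eighth roots of unity attached to a balanced family is trivial. -/
lemma SumDivisible.prod_exp_pow {q : (Fin g ⊕ Fin g → ZMod 2) → ℤ} (hq : SumDivisible q)
    {κ : Type} [Fintype κ] {s : ℕ} {v : κ → Fin g ⊕ Fin g → ZMod 2} (hv : BalancedFamily s v) :
    (∏ k, Complex.exp (Real.pi * Complex.I / 4 * q (v k))) ^ s = 1 := by
  obtain ⟨c, hc⟩ := hq κ s v hv
  rw [← Complex.exp_sum, ← Complex.exp_nat_mul, Complex.exp_eq_one_iff]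
  refine ⟨c, ?_⟩
  rw [← Finset.mul_sum]
  have : (s : ℂ) * ∑ k, (q (v k) : ℂ) = 8 * c := by exact_mod_cast hc
  linear_combination (Real.pi * Complex.I / 4 : ℂ) * this

end Families

section ThetaTransformation

open Matrix

variable {g : ℕ}

/-- The point `n + ε/2` of the half-integral lattice. -/
def latticePoint (ε : Fin g → ZMod 2) (n : Fin g → ℤ) : Fin g → ℂ :=
  fun i => (n i : ℂ) + ((ε i).val : ℂ) / 2

/-- The general term of the theta constant with characteristic `x = (δ, ε)`, normalised so that
its phase depends on `n` only. -/
def psiTerm (x : Fin g ⊕ Fin g → ZMod 2) (τ : Matrix (Fin g) (Fin g) ℂ) (n : Fin g → ℤ) : ℂ :=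
  Complex.exp (Real.pi * Complex.I * (latticePoint (x ∘ .inr) n ⬝ᵥ τ *ᵥ latticePoint (x ∘ .inr) n +
    ((∑ i, n i * ((x (.inl i)).val : ℤ) : ℤ) : ℂ)))

/-- The theta constant with characteristic `x = (δ, ε)`, up to a fourth root of unity. -/
def psi (x : Fin g ⊕ Fin g → ZMod 2) (τ : Matrix (Fin g) (Fin g) ℂ) : ℂ :=
  ∑' n, psiTerm x τ n

/-- The reduction of a symplectic matrix modulo `2`. -/
def spMod (γ : symplecticGroup (Fin g) ℤ) : Matrix (Fin g ⊕ Fin g) (Fin g ⊕ Fin g) (ZMod 2) :=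
  γ.1.map (Int.castRingHom (ZMod 2))

lemma spMod_one : spMod (1 : symplecticGroup (Fin g) ℤ) = 1 := by
  simp [spMod]

lemma spMod_mul (γ γ' : symplecticGroup (Fin g) ℤ) : spMod (γ * γ') = spMod γ * spMod γ' := by
  rw [spMod, Submonoid.coe_mul, Matrix.map_mul]
  rfl

/-- The parity of a characteristic. -/
def parity (x : Fin g ⊕ Fin g → ZMod 2) : ZMod 2 := ∑ i, x (.inl i) * x (.inr i)

/-- The affine map `x ↦ γ x + t` describes the action of `γ` on theta constants: it preserves the
parity, and products over balanced families transform with weight `8`. -/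
def TransformsBy (γ : symplecticGroup (Fin g) ℤ) (t : Fin g ⊕ Fin g → ZMod 2) : Prop :=
  (∀ x, parity (spMod γ *ᵥ x + t) = parity x) ∧
  ∀ τ ∈ Siegel (Fin g), ∀ (κ : Type) [Fintype κ] (s : ℕ) (v : κ → Fin g ⊕ Fin g → ZMod 2),
    BalancedFamily s v → (∏ k, psi (spMod γ *ᵥ v k + t) (spAct γ τ)) ^ s =
      (spDen γ τ).det ^ 8 * (∏ k, psi (v k) τ) ^ s

/-- The subgroup of those symplectic matrices for which theta constants transform as expected. -/
def transformationSubgroup (g : ℕ) : Subgroup (symplecticGroup (Fin g) ℤ) where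
  carrier := {γ | ∃ t, TransformsBy γ t}
  one_mem' := ⟨0, by simp [spMod_one], fun τ _ κ _ s v _ => by
    simp [spMod_one, spAct_one, spDen_one]⟩
  mul_mem' := by
    rintro γ γ' ⟨t, hp, ht⟩ ⟨t', hp', ht'⟩
    have h (x) : spMod (γ * γ') *ᵥ x + (spMod γ *ᵥ t' + t) =
        spMod γ *ᵥ (spMod γ' *ᵥ x + t') + t := by
      rw [spMod_mul, mulVec_add, mulVec_mulVec, add_assoc]
    refine ⟨spMod γ *ᵥ t' + t, fun x => by rw [h, hp, hp'], fun τ hτ κ _ s v hv => ?_⟩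
    simp only [h]
    rw [spAct_mul γ γ' hτ, spDen_mul γ γ' hτ, det_mul,
      ht _ (spAct_mem_siegel γ' hτ) κ s (fun k => spMod γ' *ᵥ v k + t') (hv.affine _ _),
      ht' τ hτ κ s v hv]
    ring
  inv_mem' := by
    rintro γ ⟨t, hp, ht⟩
    have h (x) : spMod γ *ᵥ (spMod γ⁻¹ *ᵥ x + -(spMod γ⁻¹ *ᵥ t)) + t = x := by
      rw [mulVec_add, mulVec_neg, mulVec_mulVec, mulVec_mulVec, ← spMod_mul]
      simp [spMod_one]
    refine ⟨-(spMod γ⁻¹ *ᵥ t), fun x => by rw [← hp, h], fun τ hτ κ _ s v hv => ?_⟩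
    have h1 := ht _ (spAct_mem_siegel γ⁻¹ hτ) κ s (fun k => spMod γ⁻¹ *ᵥ v k + -(spMod γ⁻¹ *ᵥ t))
      (hv.affine _ _)
    simp only [h] at h1
    rw [← spAct_mul _ _ hτ, mul_inv_cancel, spAct_one] at h1
    have h2 := congrArg det (spDen_mul γ γ⁻¹ hτ)
    rw [mul_inv_cancel, spDen_one, det_one, det_mul] at h2
    rw [h1, ← mul_assoc, ← mul_pow, mul_comm (det _), ← h2, one_pow, one_mul]

/-- A termwise transformation formula with eighth roots of unity gives the transformation formula
for products over balanced families. -/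
lemma transformsBy_of_psi_eq {γ : symplecticGroup (Fin g) ℤ} {t : Fin g ⊕ Fin g → ZMod 2}
    (hp : ∀ x, parity (spMod γ *ᵥ x + t) = parity x) {q : (Fin g ⊕ Fin g → ZMod 2) → ℤ}
    (hq : SumDivisible q)
    (h : ∀ τ ∈ Siegel (Fin g), ∃ c : ℂ, c ^ 16 = (spDen γ τ).det ^ 8 ∧
      ∀ x, psi (spMod γ *ᵥ x + t) (spAct γ τ) =
        c * (Complex.exp (Real.pi * Complex.I / 4 * q x) * psi x τ)) :
    TransformsBy γ t := by
  refine ⟨hp, fun τ hτ κ _ s v hv => ?_⟩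
  obtain ⟨c, hc, hx⟩ := h τ hτ
  simp only [hx, Finset.prod_mul_distrib, mul_pow, hq.prod_exp_pow hv, one_mul]
  rw [Finset.prod_const, ← pow_mul, mul_comm _ s, Finset.card_univ, hv.1, hc]

/-- A double sum of a symmetric function. -/
lemma sum_sum_of_symm {R : Type*} [CommRing R] (f : Fin g → Fin g → R)
    (hf : ∀ i j, f i j = f j i) :
    ∑ i, ∑ j, f i j = ∑ i, f i i + 2 * ∑ i, ∑ j ∈ Finset.Ioi i, f i j := by
  have h1 (i : Fin g) : ∑ j, f i j =
      ∑ j ∈ Finset.Iio i, f i j + (f i i + ∑ j ∈ Finset.Ioi i, f i j) := by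
    rw [← Finset.sum_filter_add_sum_filter_not Finset.univ (· < i)]
    have e1 : Finset.univ.filter (· < i) = Finset.Iio i := by ext; simp
    have e2 : Finset.univ.filter (fun j => ¬ j < i) = insert i (Finset.Ioi i) := by
      ext j; simp [le_iff_eq_or_lt]
    rw [e1, e2, Finset.sum_insert (by simp)]
  have h2 : ∑ i, ∑ j ∈ Finset.Iio i, f i j = ∑ i, ∑ j ∈ Finset.Ioi i, f i j := by
    rw [Finset.sum_comm' (t' := Finset.univ) (s' := fun j => Finset.Ioi j) (by simp)]
    exact Finset.sum_congr rfl fun i _ => Finset.sum_congr rfl fun j _ => hf j i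
  simp only [h1, Finset.sum_add_distrib, h2]
  ring

lemma exp_pi_mul_I_intCast_congr {a b : ℤ} (h : (a : ZMod 2) = b) :
    Complex.exp (Real.pi * Complex.I * a) = Complex.exp (Real.pi * Complex.I * b) := by
  rw [Complex.exp_eq_exp_iff_exists_int]
  obtain ⟨c, hc⟩ := (ZMod.intCast_eq_intCast_iff_dvd_sub b a 2).1 h.symm
  refine ⟨c, ?_⟩
  have : (a : ℂ) - b = 2 * c := by exact_mod_cast hc
  linear_combination (Real.pi * Complex.I : ℂ) * this

end ThetaTransformation

section Generators

open Matrix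

variable {g : ℕ}

lemma sumDivisible_apply (a : Fin g ⊕ Fin g) :
    SumDivisible fun x : Fin g ⊕ Fin g → ZMod 2 => ((x a).val : ℤ) := by
  simpa using sumDivisible_val (Pi.single a 1)

lemma sumDivisible_apply_mul_apply (a b : Fin g ⊕ Fin g) :
    SumDivisible fun x : Fin g ⊕ Fin g → ZMod 2 => 2 * (((x a).val : ℤ) * (x b).val) := by
  simpa using sumDivisible_val_mul_val (Pi.single a 1) (Pi.single b 1)

lemma val_sq_zmod_two (z : ZMod 2) : (z.val : ℤ) * z.val = z.val := by
  revert z; decide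

lemma psi_translation (S : Matrix (Fin g) (Fin g) ℤ) (hS : S.IsSymm)
    (x : Fin g ⊕ Fin g → ZMod 2) (τ : Matrix (Fin g) (Fin g) ℂ) :
    psi (Sum.elim (fun i => x (.inl i) + ∑ j, S i j * x (.inr j) + S i i) (x ∘ .inr))
      (τ + S.map (Int.cast : ℤ → ℂ)) =
    Complex.exp (Real.pi * Complex.I / 4 *
      ((∑ i, ∑ j, S i j * ((x (.inr i)).val * (x (.inr j)).val : ℤ) : ℤ) : ℂ)) * psi x τ := by
  rw [psi, psi, ← tsum_mul_left]
  refine tsum_congr fun n => ?_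
  set x' : Fin g ⊕ Fin g → ZMod 2 :=
    Sum.elim (fun i => x (.inl i) + ∑ j, S i j * x (.inr j) + S i i) (x ∘ .inr) with hx'
  have hr : x' ∘ .inr = x ∘ .inr := by simp [hx']
  set y := latticePoint (x ∘ .inr) n with hy
  set e : Fin g → ℤ := fun i => (x (.inr i)).val with he
  have hint : (((∑ i, ∑ j, S i j * (n i * n j) + ∑ i, ∑ j, S i j * (n i * e j) +
      ∑ i, n i * ((x' (.inl i)).val : ℤ) : ℤ)) : ZMod 2) =
      ((∑ i, n i * ((x (.inl i)).val : ℤ) : ℤ) : ZMod 2) := by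
    have hsq : ∀ z : ZMod 2, z * z = z := by decide
    have h2 : ∀ z : ZMod 2, z + z = 0 := by decide
    push_cast
    rw [sum_sum_of_symm (fun i j => ((S i j : ZMod 2) * (n i * n j)))
      (fun i j => by rw [hS.apply]; ring), show (2 : ZMod 2) = 0 from rfl, zero_mul, add_zero]
    rw [← Finset.sum_add_distrib, ← Finset.sum_add_distrib]
    refine Finset.sum_congr rfl fun i _ => ?_
    have e1 : ∑ j, (S i j : ZMod 2) * (n i * (e j : ZMod 2)) =
        n i * ∑ j, (S i j : ZMod 2) * x (.inr j) := by
      rw [Finset.mul_sum]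
      refine Finset.sum_congr rfl fun j _ => ?_
      simp [he]; ring
    rw [e1, hsq]
    simp [hx']
    linear_combination h2 ((S i i : ZMod 2) * n i) + h2 (n i * ∑ j, (S i j : ZMod 2) * x (.inr j))
  have hquad : y ⬝ᵥ (S.map (Int.cast : ℤ → ℂ)) *ᵥ y =
      ((∑ i, ∑ j, S i j * (n i * n j) + ∑ i, ∑ j, S i j * (n i * e j) : ℤ) : ℂ) +
      ((∑ i, ∑ j, S i j * (e i * e j) : ℤ) : ℂ) / 4 := by
    have e2 : ∑ i, ∑ j, (S i j : ℂ) * (n i * e j) = ∑ i, ∑ j, (S i j : ℂ) * (e i * n j) := by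
      rw [Finset.sum_comm]
      refine Finset.sum_congr rfl fun i _ => Finset.sum_congr rfl fun j _ => ?_
      rw [hS.apply]; ring
    have e3 : y ⬝ᵥ (S.map (Int.cast : ℤ → ℂ)) *ᵥ y = ∑ i, ∑ j, (S i j : ℂ) * (n i * n j) +
        (∑ i, ∑ j, (S i j : ℂ) * (n i * e j)) / 2 + (∑ i, ∑ j, (S i j : ℂ) * (e i * n j)) / 2 +
        (∑ i, ∑ j, (S i j : ℂ) * (e i * e j)) / 4 := by
      simp only [dotProduct, mulVec, Finset.sum_div, ← Finset.sum_add_distrib, Finset.mul_sum]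
      refine Finset.sum_congr rfl fun i _ => Finset.sum_congr rfl fun j _ => ?_
      simp [hy, latticePoint, he]; ring
    rw [e3, ← e2]; push_cast; ring
  have := exp_pi_mul_I_intCast_congr hint
  rw [psiTerm, psiTerm, hr, ← hy, add_mulVec, dotProduct_add, hquad, mul_add _ (y ⬝ᵥ τ *ᵥ y),
    Complex.exp_add (_ * (y ⬝ᵥ τ *ᵥ y)), ← this, ← Complex.exp_add, ← Complex.exp_add]
  congr 1
  simp only [he]
  push_cast
  ring

lemma spTranslation_mem (S : Matrix (Fin g) (Fin g) ℤ) (hS : S.IsSymm) :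
    spTranslation S hS ∈ transformationSubgroup g := by
  have hmod (x : Fin g ⊕ Fin g → ZMod 2) :
      spMod (spTranslation S hS) *ᵥ x + Sum.elim (fun i => (S i i : ZMod 2)) 0 =
      Sum.elim (fun i => x (.inl i) + ∑ j, S i j * x (.inr j) + S i i) (x ∘ .inr) := by
    rw [spMod, spTranslation, fromBlocks_map, fromBlocks_mulVec]
    ext (i | i) <;> simp [mulVec, dotProduct]
  refine ⟨Sum.elim (fun i => (S i i : ZMod 2)) 0, transformsBy_of_psi_eq
    (q := fun x => ∑ i, ∑ j, S i j * ((x (.inr i)).val * (x (.inr j)).val : ℤ)) ?_ ?_ ?_⟩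
  · intro x
    have hsq : ∀ z : ZMod 2, z * z = z := by decide
    rw [hmod]
    simp only [parity, Sum.elim_inl, Sum.elim_inr, Function.comp_apply, add_mul,
      Finset.sum_add_distrib, Finset.sum_mul]
    rw [sum_sum_of_symm (fun i j => (S i j : ZMod 2) * x (.inr j) * x (.inr i))
      (fun i j => by rw [hS.apply]; ring), show (2 : ZMod 2) = 0 from rfl, zero_mul, add_zero]
    simp only [mul_assoc, hsq]
    rw [add_assoc, CharTwo.add_self_eq_zero, add_zero]
  · have h (x : Fin g ⊕ Fin g → ZMod 2) :
        ∑ i, ∑ j, S i j * ((x (.inr i)).val * (x (.inr j)).val : ℤ) =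
        ∑ i, S i i * ((x (.inr i)).val : ℤ) + ∑ i, ∑ j ∈ Finset.Ioi i,
          S i j * (2 * (((x (.inr i)).val : ℤ) * (x (.inr j)).val)) := by
      rw [sum_sum_of_symm _ (fun i j => by rw [hS.apply, mul_comm ((x (.inr i)).val : ℤ)])]
      simp only [val_sq_zmod_two, Finset.mul_sum, mul_left_comm (2 : ℤ)]
    simp only [h]
    exact (SumDivisible.sum _ fun i _ => (sumDivisible_apply _).const_mul _).add
      (SumDivisible.sum _ fun i _ => SumDivisible.sum _ fun j _ =>
        (sumDivisible_apply_mul_apply _ _).const_mul _)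
  · intro τ _
    refine ⟨1, ?_, fun x => ?_⟩
    · simp [spDen, spTranslation]
    · rw [hmod, one_mul, ← psi_translation S hS]
      congr 1
      simp [spAct, spDen, spNum, spTranslation]

lemma psi_levi (U V : Matrix (Fin g) (Fin g) ℤ) (h : V * U = 1)
    (x : Fin g ⊕ Fin g → ZMod 2) (τ : Matrix (Fin g) (Fin g) ℂ) :
    psi (spMod (spLevi U V h) *ᵥ x) (U.map (Int.cast : ℤ → ℂ) * τ * (U.map (Int.cast : ℤ → ℂ))ᵀ) =
    Complex.exp (Real.pi * Complex.I / 4 *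
      ((∑ j, ∑ i, U j i * (2 * ((((spMod (spLevi U V h) *ᵥ x) (.inr j)).val : ℤ) *
        (x (.inl i)).val)) + ∑ i, (-1) * (2 * (((x (.inr i)).val : ℤ) * (x (.inl i)).val)) : ℤ) :
        ℂ)) * psi x τ := by
  set x' := spMod (spLevi U V h) *ᵥ x with hx'
  have hl (i) : x' (.inl i) = ∑ j, (U i j : ZMod 2) * x (.inl j) := by
    rw [hx', spMod, spLevi, fromBlocks_map, fromBlocks_mulVec]
    simp [mulVec, dotProduct]
  have hr (i) : x' (.inr i) = ∑ j, (V j i : ZMod 2) * x (.inr j) := by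
    rw [hx', spMod, spLevi, fromBlocks_map, fromBlocks_mulVec]
    simp [mulVec, dotProduct]
  have hk : ∀ i, ∃ k : ℤ, ∑ j, U j i * ((x' (.inr j)).val : ℤ) = (x (.inr i)).val + 2 * k := by
    intro i
    have : (((x (.inr i)).val : ℤ) : ZMod 2) =
        ((∑ j, U j i * ((x' (.inr j)).val : ℤ) : ℤ) : ZMod 2) := by
      push_cast
      simp only [ZMod.natCast_val, ZMod.cast_id', id_eq, hr]
      have hVU : ∀ l, ∑ j, (V l j : ZMod 2) * U j i = if l = i then 1 else 0 := by
        intro l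
        have := congrFun (congrFun h l) i
        rw [mul_apply, one_apply] at this
        exact_mod_cast congrArg (Int.cast : ℤ → ZMod 2) this
      simp only [Finset.mul_sum]
      rw [Finset.sum_comm]
      have : ∀ l, ∑ j, (U j i : ZMod 2) * (V l j * x (.inr l)) =
          (if l = i then 1 else 0) * x (.inr l) := by
        intro l
        rw [← hVU, Finset.sum_mul]
        exact Finset.sum_congr rfl fun j _ => by ring
      simp [this]
    obtain ⟨k, hk⟩ := (ZMod.intCast_eq_intCast_iff_dvd_sub _ _ 2).1 this
    exact ⟨k, by push_cast at hk; linarith⟩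
  choose k hk using hk
  have hUV : U * V = 1 := mul_eq_one_comm.1 h
  let e : (Fin g → ℤ) ≃ (Fin g → ℤ) :=
    { toFun := fun n => Uᵀ *ᵥ n + k
      invFun := fun n => Vᵀ *ᵥ (n - k)
      left_inv := fun n => by
        simp [mulVec_mulVec, ← transpose_mul, hUV]
      right_inv := fun n => by
        simp [mulVec_mulVec, ← transpose_mul, h] }
  rw [psi, psi, ← tsum_mul_left,
    ← e.tsum_eq (fun n => _ * psiTerm x τ n)]
  refine tsum_congr fun n => ?_
  have hpt : latticePoint (x ∘ .inr) (e n) =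
      (U.map (Int.cast : ℤ → ℂ))ᵀ *ᵥ latticePoint (x' ∘ .inr) n := by
    ext i
    have h1 : ∑ j, (U j i : ℂ) * ((x' (.inr j)).val : ℂ) = ((x (.inr i)).val : ℂ) + 2 * k i := by
      exact_mod_cast hk i
    simp only [latticePoint, e, Equiv.coe_fn_mk, mulVec, dotProduct, transpose_apply, map_apply,
      Function.comp_apply, mul_add, Finset.sum_add_distrib, Pi.add_apply, mul_div_assoc']
    rw [← Finset.sum_div, h1]
    push_cast
    ring
  have hlin : ((∑ i, n i * ((x' (.inl i)).val : ℤ) : ℤ) : ZMod 2) =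
      ((∑ i, e n i * ((x (.inl i)).val : ℤ) + ∑ i, k i * ((x (.inl i)).val : ℤ) : ℤ) :
        ZMod 2) := by
    push_cast
    simp only [ZMod.natCast_val, ZMod.cast_id', id_eq, hl, e, Equiv.coe_fn_mk, mulVec,
      dotProduct, transpose_apply, Pi.add_apply]
    push_cast
    simp only [add_mul, Finset.sum_add_distrib, Finset.sum_mul, Finset.mul_sum]
    rw [add_assoc, CharTwo.add_self_eq_zero, add_zero, Finset.sum_comm]
    exact Finset.sum_congr rfl fun i _ => Finset.sum_congr rfl fun j _ => by ring
  have hphase : (∑ j, ∑ i, U j i * (2 * (((x' (.inr j)).val : ℤ) * (x (.inl i)).val)) +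
      ∑ i, (-1) * (2 * (((x (.inr i)).val : ℤ) * (x (.inl i)).val)) : ℤ) =
      4 * ∑ i, k i * ((x (.inl i)).val : ℤ) := by
    rw [Finset.sum_comm, ← Finset.sum_add_distrib, Finset.mul_sum]
    refine Finset.sum_congr rfl fun i _ => ?_
    have : ∑ j, U j i * (2 * (((x' (.inr j)).val : ℤ) * (x (.inl i)).val)) =
        2 * (x (.inl i)).val * ∑ j, U j i * ((x' (.inr j)).val : ℤ) := by
      rw [Finset.mul_sum]
      exact Finset.sum_congr rfl fun j _ => by ring
    rw [this, hk]
    ring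
  rw [hphase, psiTerm, psiTerm, hpt, mul_add, Complex.exp_add, exp_pi_mul_I_intCast_congr hlin,
    ← Complex.exp_add, ← Complex.exp_add]
  congr 1
  have hquad : ∀ y : Fin g → ℂ, y ⬝ᵥ (U.map (Int.cast : ℤ → ℂ) * τ *
      (U.map (Int.cast : ℤ → ℂ))ᵀ) *ᵥ y = ((U.map (Int.cast : ℤ → ℂ))ᵀ *ᵥ y) ⬝ᵥ
        τ *ᵥ ((U.map (Int.cast : ℤ → ℂ))ᵀ *ᵥ y) := by
    intro y
    rw [mulVec_transpose, ← dotProduct_mulVec, mulVec_mulVec, ← mulVec_transpose,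
      mulVec_mulVec]
  rw [hquad]
  push_cast
  ring

lemma spLevi_mem (U V : Matrix (Fin g) (Fin g) ℤ) (h : V * U = 1) :
    spLevi U V h ∈ transformationSubgroup g := by
  have hUV : U * V = 1 := mul_eq_one_comm.1 h
  refine ⟨0, transformsBy_of_psi_eq (q := fun x => ∑ j, ∑ i, U j i *
      (2 * ((((spMod (spLevi U V h) *ᵥ x) (.inr j)).val : ℤ) * (x (.inl i)).val)) +
      ∑ i, (-1) * (2 * (((x (.inr i)).val : ℤ) * (x (.inl i)).val))) ?_ ?_ ?_⟩
  · intro x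
    rw [add_zero, spMod, spLevi, fromBlocks_map, fromBlocks_mulVec]
    have hp (y : Fin g ⊕ Fin g → ZMod 2) : parity y = (y ∘ .inl) ⬝ᵥ (y ∘ .inr) := rfl
    rw [hp, hp]
    simp only [Sum.elim_comp_inl, Sum.elim_comp_inr, Matrix.map_zero _ (map_zero _), zero_mulVec,
      add_zero, zero_add, transpose_map]
    rw [mulVec_transpose, dotProduct_comm, ← dotProduct_mulVec, mulVec_mulVec, ← Matrix.map_mul, h,
      Matrix.map_one _ (map_zero _) (map_one _), one_mulVec, dotProduct_comm]
  · refine (SumDivisible.sum _ fun j _ => SumDivisible.sum _ fun i _ => .const_mul ?_ _).add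
      (SumDivisible.sum _ fun i _ => (sumDivisible_apply_mul_apply _ _).const_mul _)
    simpa [mulVec] using
      sumDivisible_val_mul_val (spMod (spLevi U V h) (.inr j)) (Pi.single (.inl i) 1)
  · intro τ _
    have hden : spDen (spLevi U V h) τ = (V.map (Int.cast : ℤ → ℂ))ᵀ := by
      simp [spDen, spLevi, transpose_map]
    have hVU : V.map (Int.cast : ℤ → ℂ) * U.map (Int.cast : ℤ → ℂ) = 1 := by
      have := congrArg (fun M : Matrix (Fin g) (Fin g) ℤ => M.map (Int.castRingHom ℂ)) h
      rwa [Matrix.map_mul, Matrix.map_one _ (map_zero _) (map_one _)] at this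
    refine ⟨1, ?_, fun x => ?_⟩
    · rw [hden, det_transpose]
      have hdet : V.det * U.det = 1 := by rw [← det_mul, h, det_one]
      have hc : (V.map (Int.cast : ℤ → ℂ)).det = ((V.det : ℤ) : ℂ) :=
        ((Int.castRingHom ℂ).map_det V).symm
      rw [hc]
      rcases Int.isUnit_iff.1 (IsUnit.of_mul_eq_one _ hdet) with h1 | h1 <;> rw [h1] <;> norm_num
    · rw [add_zero, one_mul, ← psi_levi]
      congr 1
      have hinv : ((V.map (Int.cast : ℤ → ℂ))ᵀ)⁻¹ = (U.map (Int.cast : ℤ → ℂ))ᵀ :=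
        inv_eq_left_inv (by rw [← transpose_mul, hVU, transpose_one])
      rw [spAct, hden, hinv]
      simp [spNum, spLevi]

end Generators

section Summability

open Matrix

variable {g : ℕ}

/-- A product of summable nonnegative functions of separate variables is summable. -/
lemma summable_pi_prod {ι : Type*} [Fintype ι] [DecidableEq ι] {α : ι → Type*}
    [∀ i, DecidableEq (α i)] (f : ∀ i, α i → ℝ) (h0 : ∀ i a, 0 ≤ f i a) (hf : ∀ i, Summable (f i)) :
    Summable fun n : ∀ i, α i => ∏ i, f i (n i) := by
  refine summable_of_sum_le (c := ∏ i, ∑' a, f i a)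
    (fun n => Finset.prod_nonneg fun i _ => h0 i _) fun s => ?_
  have hs : s ⊆ Fintype.piFinset fun i => s.image fun n => n i := fun n hn => by
    simp only [Fintype.mem_piFinset, Finset.mem_image]
    exact fun i => ⟨n, hn, rfl⟩
  calc ∑ n ∈ s, ∏ i, f i (n i)
      ≤ ∑ n ∈ Fintype.piFinset fun i => s.image fun n => n i, ∏ i, f i (n i) :=
        Finset.sum_le_sum_of_subset_of_nonneg hs fun n _ _ =>
          Finset.prod_nonneg fun i _ => h0 i _
    _ = ∏ i, ∑ a ∈ s.image fun n => n i, f i a := (Finset.prod_univ_sum _ _).symm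
    _ ≤ ∏ i, ∑' a, f i a := Finset.prod_le_prod
        (fun i _ => Finset.sum_nonneg fun a _ => h0 i a)
        fun i _ => (hf i).sum_le_tsum _ fun a _ => h0 i a

lemma summable_exp_neg_sq {c : ℝ} (hc : 0 < c) (b : ℝ) :
    Summable fun n : ℤ => Real.exp (-Real.pi * (c * ((n : ℝ) + b) ^ 2)) := by
  have h := ((summable_jacobiTheta₂_term_iff (c * b * Complex.I) (c * Complex.I)).2
    (by simpa using hc)).norm.mul_left (Real.exp (-Real.pi * (c * b ^ 2)))
  refine h.congr fun n => ?_
  rw [norm_jacobiTheta₂_term, ← Real.exp_add]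
  congr 1
  simp
  ring

/-- A positive definite quadratic form dominates a multiple of the sum of squares. -/
lemma exists_sum_sq_le {τ : Matrix (Fin g) (Fin g) ℂ} (hτ : τ ∈ Siegel (Fin g)) :
    ∃ c > 0, ∀ v : Fin g → ℝ, c * ∑ i, v i ^ 2 ≤ ∑ i, ∑ j, v i * (τ i j).im * v j := by
  rcases Nat.eq_zero_or_pos g with rfl | hg
  · exact ⟨1, one_pos, fun v => by simp⟩
  have : Nonempty (Fin g) := ⟨⟨0, hg⟩⟩
  obtain ⟨u, hu, hmin⟩ := (isCompact_sphere (0 : Fin g → ℝ) 1).exists_isMinOn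
    (NormedSpace.sphere_nonempty.2 zero_le_one)
    (f := fun v => ∑ i, ∑ j, v i * (τ i j).im * v j) (by fun_prop)
  have hu0 : u ≠ 0 := by
    rintro rfl
    simp at hu
  have hpos := hτ.2 u hu0
  set m := ∑ i, ∑ j, u i * (τ i j).im * u j with hm
  have hg' : (0 : ℝ) < g := by exact_mod_cast hg
  refine ⟨m / g, by positivity, fun v => ?_⟩
  by_cases hv : v = 0
  · simp [hv]
  have hn : 0 < ‖v‖ := norm_pos_iff.2 hv
  have h1 : m ≤ ∑ i, ∑ j, (‖v‖⁻¹ • v) i * (τ i j).im * (‖v‖⁻¹ • v) j :=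
    hmin (show ‖v‖⁻¹ • v ∈ Metric.sphere 0 1 by simp [norm_smul, hn.ne'])
  have h2 : ∑ i, ∑ j, (‖v‖⁻¹ • v) i * (τ i j).im * (‖v‖⁻¹ • v) j =
      (‖v‖ ^ 2)⁻¹ * ∑ i, ∑ j, v i * (τ i j).im * v j := by
    simp only [Finset.mul_sum]
    refine Finset.sum_congr rfl fun i _ => Finset.sum_congr rfl fun j _ => ?_
    simp only [Pi.smul_apply, smul_eq_mul]
    field_simp
  rw [h2, le_inv_mul_iff₀ (by positivity)] at h1
  have h3 : ∑ i, v i ^ 2 ≤ g * ‖v‖ ^ 2 := by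
    calc ∑ i, v i ^ 2 ≤ ∑ _i : Fin g, ‖v‖ ^ 2 := Finset.sum_le_sum fun i _ => by
          rw [← sq_abs]
          exact pow_le_pow_left₀ (abs_nonneg _) (norm_le_pi_norm v i) 2
      _ = g * ‖v‖ ^ 2 := by simp
  calc m / g * ∑ i, v i ^ 2 ≤ m / g * (g * ‖v‖ ^ 2) := by gcongr
    _ = ‖v‖ ^ 2 * m := by field_simp
    _ ≤ _ := h1

lemma summable_psiTerm (x : Fin g ⊕ Fin g → ZMod 2) {τ : Matrix (Fin g) (Fin g) ℂ}
    (hτ : τ ∈ Siegel (Fin g)) : Summable (psiTerm x τ) := by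
  obtain ⟨c, hc, hle⟩ := exists_sum_sq_le hτ
  refine Summable.of_norm_bounded (summable_pi_prod
    (fun i (n : ℤ) => Real.exp (-Real.pi * (c * ((n : ℝ) + ((x (.inr i)).val : ℝ) / 2) ^ 2)))
    (fun _ _ => (Real.exp_pos _).le) fun i => summable_exp_neg_sq hc _) fun n => ?_
  set v : Fin g → ℝ := fun i => (n i : ℝ) + ((x (.inr i)).val : ℝ) / 2 with hv
  have hy : latticePoint (x ∘ .inr) n = fun i => (v i : ℂ) := by
    ext i
    simp only [latticePoint, hv]
    push_cast
    rfl
  have him : (latticePoint (x ∘ .inr) n ⬝ᵥ τ *ᵥ latticePoint (x ∘ .inr) n).im =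
      ∑ i, ∑ j, v i * (τ i j).im * v j := by
    simp [hy, dotProduct, mulVec, Finset.mul_sum, mul_assoc]
  rw [← Real.exp_sum, psiTerm, Complex.norm_exp, Real.exp_le_exp, ← Finset.mul_sum,
    ← Finset.mul_sum]
  have hre : ∀ (z : ℂ) (k : ℤ), ((Real.pi : ℂ) * Complex.I * (z + k)).re = -Real.pi * z.im := by
    intro z k; simp
  rw [hre, him, neg_mul, neg_mul, neg_le_neg_iff]
  exact mul_le_mul_of_nonneg_left (hle v) Real.pi_pos.le

end Summability

section Inversion

open Matrix

variable {g : ℕ}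

/-- The one-dimensional inversion formula, with characteristics. -/
lemma tsum_exp_inversion (t w : ℂ) (ht : t ≠ 0) (a b : ℤ) :
    ∑' n : ℤ, Complex.exp (Real.pi * Complex.I *
      (t * ((n : ℂ) + b / 2) ^ 2 + 2 * ((n : ℂ) + b / 2) * w + n * a)) =
    1 / (-Complex.I * t) ^ (1 / 2 : ℂ) * Complex.exp (Real.pi * Complex.I * (a * b / 2)) *
      ∑' n : ℤ, Complex.exp (Real.pi * Complex.I *
        (-((n : ℂ) + a / 2 - w) ^ 2 / t + n * b)) := by
  have h := jacobiTheta₂_functional_equation ((t * b + 2 * w + a) / 2) t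
  rw [jacobiTheta₂, jacobiTheta₂] at h
  have h1 : ∀ n : ℤ, Complex.exp (Real.pi * Complex.I *
      (t * ((n : ℂ) + b / 2) ^ 2 + 2 * ((n : ℂ) + b / 2) * w + n * a)) =
      Complex.exp (Real.pi * Complex.I * (t * b ^ 2 / 4 + b * w)) *
        jacobiTheta₂_term n ((t * b + 2 * w + a) / 2) t := fun n => by
    rw [jacobiTheta₂_term, ← Complex.exp_add]
    congr 1
    ring
  simp only [h1]
  rw [tsum_mul_left, h, ← (Equiv.addRight a).tsum_eq (fun n => jacobiTheta₂_term n _ (-1 / t)),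
    mul_assoc (1 / _ : ℂ), mul_left_comm, mul_assoc (1 / _ : ℂ)]
  congr 1
  rw [← tsum_mul_left, ← tsum_mul_left, ← tsum_mul_left]
  refine tsum_congr fun n => ?_
  rw [jacobiTheta₂_term, ← Complex.exp_add, ← Complex.exp_add, ← Complex.exp_add]
  congr 1
  simp only [Equiv.coe_addRight]
  push_cast
  field_simp
  ring

lemma spMod_spInversion_mulVec (j : Fin g) (x : Fin g ⊕ Fin g → ZMod 2) :
    spMod (spInversion j) *ᵥ x =
      Sum.elim (Function.update (x ∘ .inl) j (x (.inr j)))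
        (Function.update (x ∘ .inr) j (x (.inl j))) := by
  have hneg : ∀ z : ZMod 2, -z = z := by decide
  have hE : ((coordProj j : Matrix (Fin g) (Fin g) ℤ).map (Int.castRingHom (ZMod 2))) =
      coordProj j := by
    ext a b
    simp only [coordProj, diagonal_apply, map_apply, Pi.single_apply]
    split_ifs <;> simp
  have hE' : ((1 - coordProj j : Matrix (Fin g) (Fin g) ℤ).map (Int.castRingHom (ZMod 2))) =
      1 - coordProj j := by
    rw [← hE]
    ext a b
    by_cases hab : a = b <;> simp [hab]
  have hE'' : ((-coordProj j : Matrix (Fin g) (Fin g) ℤ).map (Int.castRingHom (ZMod 2))) =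
      -coordProj j := by
    rw [← hE]
    ext a b
    simp
  rw [spMod, spInversion, fromBlocks_map, fromBlocks_mulVec, hE, hE', hE'']
  congr 1 <;> ext k <;> by_cases hk : k = j
  all_goals simp [sub_mulVec, coordProj, mulVec_diagonal, hk, hneg]

lemma spDen_spInversion (j : Fin g) (τ : Matrix (Fin g) (Fin g) ℂ) :
    spDen (spInversion j) τ = updateRow 1 j (τ j) := by
  ext a b
  by_cases ha : a = j
  · subst ha
    by_cases hb : a = b <;> simp [spDen, spInversion, coordProj, mul_apply, diagonal_apply,
      updateRow_apply, one_apply, hb, Pi.single_apply]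
  · simp [spDen, spInversion, coordProj, mul_apply, diagonal_apply, updateRow_apply, one_apply, ha,
      Pi.single_apply]

lemma det_spDen_spInversion (j : Fin g) (τ : Matrix (Fin g) (Fin g) ℂ) :
    (spDen (spInversion j) τ).det = τ j j := by
  rw [spDen_spInversion, ← cramer_transpose_apply, transpose_one, cramer_one]
  rfl

/-- The quadratic form of `τ` along the `j`-th coordinate axis. -/
lemma quadratic_add_single (j : Fin g) {τ : Matrix (Fin g) (Fin g) ℂ} (hτ : τ.IsSymm)
    (y : Fin g → ℂ) (u : ℂ) :
    (y + Pi.single j u) ⬝ᵥ τ *ᵥ (y + Pi.single j u) =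
      y ⬝ᵥ τ *ᵥ y + (τ j j * u ^ 2 + 2 * u * (τ *ᵥ y) j) := by
  have h1 : y ⬝ᵥ τ *ᵥ Pi.single j u = u * (τ *ᵥ y) j := by
    rw [dotProduct_mulVec, ← mulVec_transpose, hτ.eq, dotProduct_single, mul_comm]
  rw [mulVec_add, add_dotProduct, dotProduct_add, dotProduct_add, h1, single_dotProduct,
    single_dotProduct]
  simp
  ring

/-- The quadratic form of the inverted point along the `j`-th coordinate axis. -/
lemma quadratic_spInversion (j : Fin g) {τ : Matrix (Fin g) (Fin g) ℂ} (hτ : τ ∈ Siegel (Fin g))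
    (h0 : τ j j ≠ 0) {y : Fin g → ℂ} (hy : y j = 0) (u : ℂ) :
    (y + Pi.single j u) ⬝ᵥ spAct (spInversion j) τ *ᵥ (y + Pi.single j u) =
      y ⬝ᵥ τ *ᵥ y + -(u - (τ *ᵥ y) j) ^ 2 / τ j j := by
  set w := (τ *ᵥ y) j with hw
  have hden (z : Fin g → ℂ) (k) : (spDen (spInversion j) τ *ᵥ z) k =
      if k = j then (τ *ᵥ z) j else z k := by
    rw [spDen_spInversion]
    by_cases hk : k = j
    · subst hk; simp [mulVec, updateRow_self]
    · simp [mulVec, dotProduct, hk, one_apply]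
  have hnum (z : Fin g → ℂ) (k) : (spNum (spInversion j) τ *ᵥ z) k =
      if k = j then -z j else (τ *ᵥ z) k := by
    have : spNum (spInversion j) τ = updateRow τ j (-Pi.single j 1) := by
      ext a b
      by_cases ha : a = j
      · subst ha
        by_cases hb : a = b <;> simp [spNum, spInversion, coordProj, mul_apply, diagonal_apply,
          updateRow_apply, one_apply, hb, Pi.single_apply]
      · simp [spNum, spInversion, coordProj, mul_apply, diagonal_apply, updateRow_apply, one_apply,
          ha, Pi.single_apply]
    rw [this]
    by_cases hk : k = j
    · subst hk; simp [mulVec, dotProduct, Pi.single_apply]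
    · simp [mulVec, hk]
  have hact (z : Fin g → ℂ) : spAct (spInversion j) τ *ᵥ (spDen (spInversion j) τ *ᵥ z) =
      spNum (spInversion j) τ *ᵥ z := by
    rw [mulVec_mulVec, spAct_mul_spDen _ hτ]
  set s := (u - w) / τ j j with hs
  have hsu : u = w + τ j j * s := by rw [hs]; field_simp; ring
  have hz : spDen (spInversion j) τ *ᵥ (y + Pi.single j s) = y + Pi.single j u := by
    ext k
    rw [hden]
    by_cases hk : k = j
    · subst hk
      simp [mulVec_add, ← hw, hy, hsu, mul_comm]
    · simp [hk]
  rw [← hz, hact]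
  have hN : spNum (spInversion j) τ *ᵥ (y + Pi.single j s) =
      τ *ᵥ y + s • (fun k => τ k j) + Pi.single j (-(w + s * τ j j + s)) := by
    ext k
    rw [hnum]
    by_cases hk : k = j
    · subst hk
      simp [hy, ← hw]
      ring
    · simp [hk, mulVec_add, mul_comm]
  have hcol : y ⬝ᵥ (fun k => τ k j) = w := by
    rw [hw, mulVec, dotProduct_comm]
    congr 1
    ext k
    exact hτ.1.apply _ _
  rw [hN, hz, add_dotProduct, dotProduct_add, dotProduct_add, dotProduct_smul, hcol,
    dotProduct_single, hy, single_dotProduct]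
  simp [← hw]
  rw [hsu]
  field_simp
  ring

/-- Summation over the lattice fibred along the `j`-th coordinate axis. -/
lemma tsum_fiber (j : Fin g) {f : (Fin g → ℤ) → ℂ} (hf : Summable f) :
    ∑' n, f n = ∑' m : {k // k ≠ j} → ℤ, ∑' n : ℤ,
      f (Function.update (fun k => if h : k = j then 0 else m ⟨k, h⟩) j n) := by
  let e := (Equiv.prodComm _ _).trans (Equiv.funSplitAt j ℤ).symm
  have hs : Summable fun c => f (e c) := e.summable_iff.2 hf
  rw [← e.tsum_eq, hs.tsum_prod]
  refine tsum_congr fun m => tsum_congr fun n => congrArg f ?_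
  ext k
  by_cases hk : k = j
  · subst hk; simp [e]
  · simp [e, hk]

/-- The terms of the theta series along the `j`-th coordinate axis. -/
lemma latticePoint_update (ε : Fin g → ZMod 2) (p : Fin g → ℤ) (j : Fin g) (n : ℤ) :
    latticePoint ε (Function.update p j n) =
      Function.update (latticePoint ε p) j 0 + Pi.single j ((n : ℂ) + ((ε j).val : ℂ) / 2) := by
  ext k
  by_cases hk : k = j
  · subst hk; simp [latticePoint]
  · simp [latticePoint, hk]

lemma sum_update_mul (d p : Fin g → ℤ) (j : Fin g) (hp : p j = 0) (n : ℤ) :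
    ∑ i, Function.update p j n i * d i = n * d j + ∑ i, p i * d i := by
  rw [Fintype.sum_eq_add_sum_compl j, Fintype.sum_eq_add_sum_compl j (fun i => p i * d i), hp]
  simp only [Function.update_self, zero_mul, zero_add]
  congr 1
  refine Finset.sum_congr rfl fun i hi => ?_
  rw [Function.update_of_ne (by simpa using hi)]

lemma psi_inversion (j : Fin g) (x : Fin g ⊕ Fin g → ZMod 2) {τ : Matrix (Fin g) (Fin g) ℂ}
    (hτ : τ ∈ Siegel (Fin g)) (h0 : τ j j ≠ 0) :
    psi x τ = 1 / (-Complex.I * τ j j) ^ (1 / 2 : ℂ) *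
      Complex.exp (Real.pi * Complex.I * ((x (.inl j)).val * (x (.inr j)).val / 2)) *
      psi (spMod (spInversion j) *ᵥ x) (spAct (spInversion j) τ) := by
  rw [psi, psi, tsum_fiber j (summable_psiTerm x hτ),
    tsum_fiber j (summable_psiTerm _ (spAct_mem_siegel _ hτ)), ← tsum_mul_left]
  refine tsum_congr fun m => ?_
  set p : Fin g → ℤ := fun k => if h : k = j then 0 else m ⟨k, h⟩ with hp
  have hpj : p j = 0 := by simp [hp]
  set y := Function.update (latticePoint (x ∘ .inr) p) j 0 with hy
  have hyj : y j = 0 := by simp [hy]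
  set K := y ⬝ᵥ τ *ᵥ y + ((∑ i, p i * ((x (.inl i)).val : ℤ) : ℤ) : ℂ) with hK
  rw [spMod_spInversion_mulVec]
  set x' : Fin g ⊕ Fin g → ZMod 2 := Sum.elim (Function.update (x ∘ .inl) j (x (.inr j)))
    (Function.update (x ∘ .inr) j (x (.inl j))) with hx'
  have hy' : Function.update (latticePoint (x' ∘ .inr) p) j 0 = y := by
    ext k
    by_cases hk : k = j
    · subst hk; simp [hy]
    · simp [hy, hk, latticePoint, hx']
  have hL : ∑ i, p i * ((x' (.inl i)).val : ℤ) = ∑ i, p i * ((x (.inl i)).val : ℤ) := by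
    refine Finset.sum_congr rfl fun i _ => ?_
    by_cases hi : i = j
    · subst hi; simp [hpj]
    · simp [hx', hi]
  have h1 : ∀ n : ℤ, psiTerm x τ (Function.update p j n) =
      Complex.exp (Real.pi * Complex.I * K) * Complex.exp (Real.pi * Complex.I *
      (τ j j * ((n : ℂ) + (((x (.inr j)).val : ℤ) : ℂ) / 2) ^ 2 +
        2 * ((n : ℂ) + (((x (.inr j)).val : ℤ) : ℂ) / 2) * (τ *ᵥ y) j +
        n * (((x (.inl j)).val : ℤ) : ℂ))) := fun n => by
    rw [psiTerm, latticePoint_update, ← hy, quadratic_add_single j hτ.1,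
      sum_update_mul _ _ _ hpj, ← Complex.exp_add]
    congr 1
    rw [hK, Function.comp_apply]
    push_cast
    ring
  have h2 : ∀ n : ℤ, psiTerm x' (spAct (spInversion j) τ) (Function.update p j n) =
      Complex.exp (Real.pi * Complex.I * K) * Complex.exp (Real.pi * Complex.I *
      (-((n : ℂ) + (((x (.inl j)).val : ℤ) : ℂ) / 2 - (τ *ᵥ y) j) ^ 2 / τ j j +
        n * (((x (.inr j)).val : ℤ) : ℂ))) := fun n => by
    rw [psiTerm, latticePoint_update, hy', quadratic_spInversion j hτ h0 hyj,
      sum_update_mul _ _ _ hpj, hL, ← Complex.exp_add]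
    have e1 : x' (.inl j) = x (.inr j) := by simp [hx']
    have e2 : (x' ∘ .inr) j = x (.inl j) := by simp [hx']
    congr 1
    rw [hK, e1, e2]
    push_cast
    ring
  simp only [h1, h2, tsum_mul_left]
  rw [tsum_exp_inversion _ _ h0]
  push_cast
  ring

lemma spInversion_mem (j : Fin g) : spInversion j ∈ transformationSubgroup g := by
  refine ⟨0, transformsBy_of_psi_eq
    (q := fun x => (-1) * (2 * (((x (.inl j)).val : ℤ) * (x (.inr j)).val))) ?_
    ((sumDivisible_apply_mul_apply _ _).const_mul _) ?_⟩
  · intro x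
    rw [add_zero, spMod_spInversion_mulVec]
    refine Finset.sum_congr rfl fun i _ => ?_
    by_cases hi : i = j
    · subst hi; simp [mul_comm]
    · simp [hi]
  · intro τ hτ
    have h0 : τ j j ≠ 0 := by
      intro h
      have := hτ.2 (Pi.single j 1) (by simp)
      simp [Pi.single_apply, h] at this
    have hI : -Complex.I * τ j j ≠ 0 := mul_ne_zero (neg_ne_zero.2 Complex.I_ne_zero) h0
    have hc : (-Complex.I * τ j j) ^ (1 / 2 : ℂ) ≠ 0 := by simp [Complex.cpow_eq_zero_iff, h0]
    refine ⟨(-Complex.I * τ j j) ^ (1 / 2 : ℂ), ?_, fun x => ?_⟩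
    · rw [det_spDen_spInversion, ← Complex.cpow_nat_mul,
        show ((16 : ℕ) : ℂ) * (1 / 2) = ((8 : ℕ) : ℂ) by norm_num, Complex.cpow_natCast, mul_pow]
      have : (-Complex.I) ^ 8 = 1 := by
        rw [show 8 = 2 * 4 by norm_num, pow_mul, neg_sq, Complex.I_sq]; norm_num
      rw [this, one_mul]
    · rw [add_zero, psi_inversion j x hτ h0]
      have he : Complex.exp (Real.pi * Complex.I / 4 *
          (((-1) * (2 * (((x (.inl j)).val : ℤ) * (x (.inr j)).val)) : ℤ) : ℂ)) *
          Complex.exp (Real.pi * Complex.I * ((x (.inl j)).val * (x (.inr j)).val / 2)) = 1 := by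
        rw [← Complex.exp_add, Complex.exp_eq_one_iff]
        refine ⟨0, ?_⟩
        push_cast
        ring
      set P := psi (spMod (spInversion j) *ᵥ x) (spAct (spInversion j) τ)
      rw [mul_assoc (1 / _ : ℂ), mul_left_comm (Complex.exp _) (1 / _ : ℂ), ← mul_assoc, ← mul_assoc,
        mul_one_div_cancel hc, mul_assoc, ← mul_assoc (Complex.exp _), he]
      simp

/-- Every symplectic matrix acts on theta constants through an affine map. -/
theorem exists_transformsBy (γ : symplecticGroup (Fin g) ℤ) : ∃ t, TransformsBy γ t :=
  ContainsGenerators.mem (H := transformationSubgroup g)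
    ⟨spTranslation_mem, spLevi_mem, spInversion_mem⟩ γ

end Inversion

section Subspaces

open Matrix

variable {g : ℕ}

/-- The identification of characteristics `(ε, δ)` with vectors `(δ, ε)`. -/
def charVec (g : ℕ) : Char2 (Fin g) ≃ₗ[ZMod 2] (Fin g ⊕ Fin g → ZMod 2) :=
  (LinearEquiv.prodComm _ _ _).trans (LinearEquiv.sumArrowLequivProdArrow _ _ _ _).symm

lemma thetaConst_eq_psi (m : Char2 (Fin g)) (τ : Matrix (Fin g) (Fin g) ℂ) :
    thetaConst m τ = Complex.exp (Real.pi * Complex.I / 4 *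
      ((∑ i, 2 * (((charVec g m (.inr i)).val : ℤ) * (charVec g m (.inl i)).val) : ℤ) : ℂ)) *
        psi (charVec g m) τ := by
  rw [thetaConst, thetaChar, theta, psi, ← tsum_mul_left]
  refine tsum_congr fun n => ?_
  rw [psiTerm, ← Complex.exp_add]
  congr 1
  have hl (i) : charVec g m (.inl i) = m.2 i := rfl
  have hr (i) : charVec g m (.inr i) = m.1 i := rfl
  have hq : latticePoint (charVec g m ∘ .inr) n ⬝ᵥ τ *ᵥ latticePoint (charVec g m ∘ .inr) n =
      ∑ i, ∑ j, ((n i : ℂ) + ((m.1 i).val : ℂ) / 2) * τ i j *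
        ((n j : ℂ) + ((m.1 j).val : ℂ) / 2) := by
    simp only [dotProduct, mulVec, Finset.mul_sum, latticePoint, Function.comp_apply, hr,
      mul_assoc]
  have hs : 2 * ∑ i, ((n i : ℂ) + ((m.1 i).val : ℂ) / 2) *
      ((0 : Fin g → ℂ) i + ((m.2 i).val : ℂ) / 2) =
      (∑ i, (n i : ℂ) * ((m.2 i).val : ℂ)) +
        (∑ i, 2 * (((m.1 i).val : ℂ) * ((m.2 i).val : ℂ))) / 4 := by
    rw [Finset.mul_sum, Finset.sum_div, ← Finset.sum_add_distrib]
    refine Finset.sum_congr rfl fun i _ => ?_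
    rw [Pi.zero_apply]
    ring
  rw [hq, hs]
  simp only [hl, hr]
  push_cast
  ring

/-- A linear subspace of dimension `i ≤ 4` is a balanced family. -/
lemma IsLinearSubspaceDim.balancedFamily {i : ℕ} (hi : i ≤ 4) {W : Finset (Char2 (Fin g))}
    (hW : IsLinearSubspaceDim i W) :
    BalancedFamily (2 ^ (4 - i)) fun w : W => charVec g w := by
  obtain ⟨V, hV, hWV⟩ := hW
  have hmem (w) : w ∈ W ↔ w ∈ V := by
    rw [← Finset.mem_coe, hWV, SetLike.mem_coe]
  have hcard : W.card = 2 ^ i := by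
    rw [← Set.ncard_coe_finset, hWV, ← Nat.card_coe_set_eq, ← hV]
    exact (Module.natCard_eq_pow_finrank (K := ZMod 2) (V := V)).trans (by simp)
  have h16 : 2 ^ (4 - i) * Fintype.card W = 16 := by
    rw [Fintype.card_coe, hcard, ← pow_add, Nat.sub_add_cancel hi]
    norm_num
  refine ⟨h16, fun a => ?_⟩
  by_cases h : ∀ w ∈ W, a ⬝ᵥ charVec g w = 0
  · have : ∑ k : W, sgn2 (a ⬝ᵥ charVec g k) = Fintype.card W := by
      rw [Finset.sum_congr rfl fun k _ => by rw [h k k.2]]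
      simp [sgn2]
    rw [this]
    exact dvd_of_eq (by exact_mod_cast h16.symm)
  · push Not at h
    obtain ⟨w, hw, hne⟩ := h
    have h1 : a ⬝ᵥ charVec g w = 1 := by
      revert hne
      generalize a ⬝ᵥ charVec g w = z
      revert z
      decide
    have h2 : ∀ v : Char2 (Fin g), v + w + w = v := fun v => by
      ext k <;> simp [add_assoc, CharTwo.add_self_eq_zero]
    have h3 : ∑ v ∈ W, sgn2 (a ⬝ᵥ charVec g v) = ∑ v ∈ W, -sgn2 (a ⬝ᵥ charVec g v) := by
      refine Finset.sum_nbij' (· + w) (· + w) ?_ ?_ (fun v _ => h2 v) (fun v _ => h2 v) ?_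
      · exact fun v hv => (hmem _).2 (V.add_mem ((hmem v).1 hv) ((hmem w).1 hw))
      · exact fun v hv => (hmem _).2 (V.add_mem ((hmem v).1 hv) ((hmem w).1 hw))
      · intro v _
        rw [map_add, dotProduct_add, sgn2_add, h1, show sgn2 1 = -1 from rfl, mul_neg_one, neg_neg]
    rw [Finset.sum_neg_distrib] at h3
    rw [Finset.sum_coe_sort W fun v => sgn2 (a ⬝ᵥ charVec g v), show
      ∑ v ∈ W, sgn2 (a ⬝ᵥ charVec g v) = 0 by omega, mul_zero]
    exact dvd_zero _

lemma IsLinearSubspaceDim.prod_thetaConst_pow {i : ℕ} (hi : i ≤ 4) {W : Finset (Char2 (Fin g))}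
    (hW : IsLinearSubspaceDim i W) (τ : Matrix (Fin g) (Fin g) ℂ) :
    (∏ w ∈ W, thetaConst w τ) ^ 2 ^ (4 - i) =
      (∏ w ∈ W, psi (charVec g w) τ) ^ 2 ^ (4 - i) := by
  have hq : SumDivisible fun x : Fin g ⊕ Fin g → ZMod 2 =>
      ∑ i, 2 * (((x (.inr i)).val : ℤ) * (x (.inl i)).val) :=
    SumDivisible.sum _ fun i _ => sumDivisible_apply_mul_apply _ _
  have h := hq.prod_exp_pow (hW.balancedFamily hi)
  rw [Finset.prod_coe_sort W fun w => Complex.exp (Real.pi * Complex.I / 4 *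
    ((∑ i, 2 * (((charVec g w (.inr i)).val : ℤ) * (charVec g w (.inl i)).val) : ℤ) : ℂ))] at h
  simp only [thetaConst_eq_psi, Finset.prod_mul_distrib, mul_pow, h, one_mul]

lemma IsLinearSubspaceDim.map {i : ℕ} {W : Finset (Char2 (Fin g))}
    (hW : IsLinearSubspaceDim i W) (e : Char2 (Fin g) ≃ₗ[ZMod 2] Char2 (Fin g)) :
    IsLinearSubspaceDim i (W.map e.toEquiv.toEmbedding) := by
  obtain ⟨V, hV, hWV⟩ := hW
  refine ⟨V.map (e : Char2 (Fin g) →ₗ[ZMod 2] Char2 (Fin g)), ?_, ?_⟩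
  · rw [LinearEquiv.finrank_map_eq, hV]
  · rw [Finset.coe_map, hWV]
    rfl

/-- The action of a symplectic matrix on characteristics. -/
def charEquiv (γ : symplecticGroup (Fin g) ℤ) : Char2 (Fin g) ≃ₗ[ZMod 2] Char2 (Fin g) :=
  (charVec g).trans ((toLin'OfInv (M := spMod γ⁻¹) (M' := spMod γ)
    (by rw [← spMod_mul, inv_mul_cancel, spMod_one])
    (by rw [← spMod_mul, mul_inv_cancel, spMod_one])).trans (charVec g).symm)

lemma charVec_charEquiv (γ : symplecticGroup (Fin g) ℤ) (m : Char2 (Fin g)) :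
    charVec g (charEquiv γ m) = spMod γ *ᵥ charVec g m := by
  simp [charEquiv, toLin'OfInv]

/-- The forms `P` are modular for every symplectic matrix acting linearly on characteristics. -/
lemma Pform_spAct {γ : symplecticGroup (Fin g) ℤ} (hγ : TransformsBy γ 0) {i : ℕ} (hi : i ≤ 4)
    {τ : Matrix (Fin g) (Fin g) ℂ} (hτ : τ ∈ Siegel (Fin g)) :
    Pform (Fin g) i (2 ^ (4 - i)) (spAct γ τ) =
      (spDen γ τ).det ^ 8 * Pform (Fin g) i (2 ^ (4 - i)) τ := by
  rw [Pform, Pform, Finset.mul_sum]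
  symm
  refine Finset.sum_nbij' (fun W => W.map (charEquiv γ).toEquiv.toEmbedding)
    (fun W => W.map (charEquiv γ).symm.toEquiv.toEmbedding) ?_ ?_ ?_ ?_ ?_
  · intro W hW
    simp only [Finset.mem_filter, Finset.mem_univ, true_and] at hW ⊢
    exact hW.map _
  · intro W hW
    simp only [Finset.mem_filter, Finset.mem_univ, true_and] at hW ⊢
    exact hW.map _
  · intro W _
    ext m
    simp
  · intro W _
    ext m
    simp
  · intro W hW
    simp only [Finset.mem_filter, Finset.mem_univ, true_and] at hW
    rw [hW.prod_thetaConst_pow hi, (hW.map _).prod_thetaConst_pow hi, Finset.prod_map]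
    have h := hγ.2 τ hτ W _ _ (hW.balancedFamily hi)
    rw [Finset.prod_coe_sort W fun w => psi (charVec g w) τ,
      Finset.prod_coe_sort W fun w => psi (spMod γ *ᵥ charVec g w + 0) (spAct γ τ)] at h
    rw [← h]
    congr 1
    refine Finset.prod_congr rfl fun w _ => ?_
    rw [add_zero, ← charVec_charEquiv]
    rfl

end Subspaces

section ThetaGroup

open Matrix

variable {g : ℕ}

lemma parity_add (x y : Fin g ⊕ Fin g → ZMod 2) :
    parity (x + y) = parity x + parity y +
      ((x ∘ .inl) ⬝ᵥ (y ∘ .inr) + (x ∘ .inr) ⬝ᵥ (y ∘ .inl)) := by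
  simp only [parity, dotProduct, ← Finset.sum_add_distrib]
  refine Finset.sum_congr rfl fun i _ => ?_
  simp only [Pi.add_apply, Function.comp_apply]
  ring

/-- A translation preserving the parity is trivial. -/
lemma eq_zero_of_parity_add {t : Fin g ⊕ Fin g → ZMod 2}
    (h : ∀ y, parity (y + t) = parity y) : t = 0 := by
  have h0 : parity t = 0 := by simpa [parity] using h 0
  have h1 (y : Fin g ⊕ Fin g → ZMod 2) :
      (y ∘ .inl) ⬝ᵥ (t ∘ .inr) + (y ∘ .inr) ⬝ᵥ (t ∘ .inl) = 0 := by
    have := h y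
    rw [parity_add, h0, add_zero] at this
    exact left_eq_add.1 this.symm
  ext (i | i)
  · have := h1 (Sum.elim 0 (Pi.single i 1))
    rwa [Sum.elim_comp_inl, Sum.elim_comp_inr, zero_dotProduct, zero_add,
      single_one_dotProduct] at this
  · have := h1 (Sum.elim (Pi.single i 1) 0)
    rwa [Sum.elim_comp_inl, Sum.elim_comp_inr, zero_dotProduct, add_zero,
      single_one_dotProduct] at this

/-- An alternating form over `𝔽₂` vanishes on the diagonal. -/
lemma dotProduct_mulVec_self_eq_zero {N : Matrix (Fin g) (Fin g) (ZMod 2)} (hN : N.IsSymm)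
    (hd : ∀ i, N i i = 0) (v : Fin g → ZMod 2) : v ⬝ᵥ N *ᵥ v = 0 := by
  simp only [dotProduct, mulVec, Finset.mul_sum]
  rw [sum_sum_of_symm _ fun i j => by rw [hN.apply]; ring, show (2 : ZMod 2) = 0 from rfl]
  simp [hd]

/-- A matrix in `Γ(1,2)` acts linearly on characteristics. -/
lemma InGammaOneTwo.transformsBy_zero {A B C D : Matrix (Fin g) (Fin g) ℤ}
    (hγ : InGammaOneTwo A B C D) (hmem : fromBlocks A B C D ∈ symplecticGroup (Fin g) ℤ) :
    TransformsBy ⟨fromBlocks A B C D, hmem⟩ 0 := by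
  obtain ⟨t, ht⟩ := exists_transformsBy ⟨fromBlocks A B C D, hmem⟩
  suffices t = 0 from this ▸ ht
  obtain ⟨hAB, hCD, hAD⟩ := symplectic_block_relations hmem
  let r : Matrix (Fin g) (Fin g) ℤ → Matrix (Fin g) (Fin g) (ZMod 2) :=
    fun M => M.map (Int.castRingHom (ZMod 2))
  have hrmul (M N) : r (M * Nᵀ) = r M * (r N)ᵀ := Matrix.map_mul
  have hdiag {M : Matrix (Fin g) (Fin g) ℤ} (hM : ∀ i, M i i % 2 = 0) (i) : r M i i = 0 := by
    simpa [r] using (ZMod.intCast_zmod_eq_zero_iff_dvd (M i i) 2).2 (Int.dvd_of_emod_eq_zero (hM i))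
  have h1 : r A * (r B)ᵀ = r B * (r A)ᵀ := by rw [← hrmul, hAB, hrmul]
  have h2 : r C * (r D)ᵀ = r D * (r C)ᵀ := by rw [← hrmul, hCD, hrmul]
  have h3 : r A * (r D)ᵀ + r B * (r C)ᵀ = 1 := by
    have : r (A * Dᵀ - B * Cᵀ) = 1 := by
      rw [hAD]; exact Matrix.map_one _ (map_zero _) (map_one _)
    rw [← this, ← hrmul, ← hrmul]
    ext i j
    simp [r, sub_eq_add_neg, ZMod.neg_eq_self_mod_two]
  have h4 : r D * (r A)ᵀ + r C * (r B)ᵀ = 1 := by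
    have := congrArg transpose h3
    simpa [transpose_add, transpose_mul] using this
  have hneg (M : Matrix (Fin g) (Fin g) (ZMod 2)) : M + M = 0 := by
    ext i j
    exact CharTwo.add_self_eq_zero _
  refine eq_zero_of_parity_add fun y => ?_
  set z := fromBlocks (r D)ᵀ (r B)ᵀ (r C)ᵀ (r A)ᵀ *ᵥ y with hz
  have hy : spMod ⟨fromBlocks A B C D, hmem⟩ *ᵥ z = y := by
    have : spMod ⟨fromBlocks A B C D, hmem⟩ = fromBlocks (r A) (r B) (r C) (r D) :=
      fromBlocks_map _ _ _ _ _
    rw [hz, mulVec_mulVec, this, fromBlocks_multiply, h3, h1, hneg, h2, hneg, add_comm (r C * _),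
      h4, fromBlocks_one, one_mulVec]
  have hp (y : Fin g ⊕ Fin g → ZMod 2) : parity y = (y ∘ .inl) ⬝ᵥ (y ∘ .inr) := rfl
  have hpz : parity z = parity y := by
    rw [hp, hp, hz, fromBlocks_mulVec, Sum.elim_comp_inl, Sum.elim_comp_inr]
    set d := y ∘ .inl
    set e := y ∘ .inr
    have hmv (M N : Matrix (Fin g) (Fin g) (ZMod 2)) (u v : Fin g → ZMod 2) :
        (Mᵀ *ᵥ u) ⬝ᵥ (Nᵀ *ᵥ v) = u ⬝ᵥ (M * Nᵀ) *ᵥ v := by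
      rw [mulVec_transpose, ← dotProduct_mulVec, mulVec_mulVec]
    have hsymm {M N : Matrix (Fin g) (Fin g) (ZMod 2)} (h : M * Nᵀ = N * Mᵀ) :
        (N * Mᵀ).IsSymm := by
      rw [IsSymm, transpose_mul, transpose_transpose, h]
    have e1 : d ⬝ᵥ (r D * (r C)ᵀ) *ᵥ d = 0 :=
      dotProduct_mulVec_self_eq_zero (hsymm h2)
        (fun i => by rw [← h2, ← hrmul]; exact hdiag hγ.2.2 i) d
    have e2 : e ⬝ᵥ (r B * (r A)ᵀ) *ᵥ e = 0 :=
      dotProduct_mulVec_self_eq_zero (hsymm h1)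
        (fun i => by rw [← h1, ← hrmul]; exact hdiag hγ.2.1 i) e
    have e3 : e ⬝ᵥ (r B * (r C)ᵀ) *ᵥ d = d ⬝ᵥ (r C * (r B)ᵀ) *ᵥ e := by
      rw [← hmv, ← hmv, dotProduct_comm]
    rw [add_dotProduct, dotProduct_add, dotProduct_add, hmv, hmv, hmv, hmv, e1, e2, e3, zero_add,
      add_zero, ← dotProduct_add, ← add_mulVec, h4, one_mulVec]
  rw [← hpz, ← ht.1 z, hy]

end ThetaGroup

/-- `P_{i,2^{4−i}}^g` is a modular form of weight 8 with respect to `Γ_g(1,2)`. -/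
theorem Pform_modular (g i : ℕ) (hg : 1 ≤ g) (hi : i ≤ min g 4)
    (A B C D : Matrix (Fin g) (Fin g) ℤ) (hγ : InGammaOneTwo A B C D)
    (τ : Matrix (Fin g) (Fin g) ℂ) (hτ : τ ∈ Siegel (Fin g)) :
    Pform (Fin g) i (2 ^ (4 - i)) (symplAction A B C D τ) =
      (C.map (Int.cast : ℤ → ℂ) * τ + D.map (Int.cast : ℤ → ℂ)).det ^ 8 *
        Pform (Fin g) i (2 ^ (4 - i)) τ := by
  have hmem : Matrix.fromBlocks A B C D ∈ Matrix.symplecticGroup (Fin g) ℤ := by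
    rw [SymplecticGroup.mem_iff]
    have hJ : Matrix.J (Fin g) ℤ = -symplJ g := by
      simp [Matrix.J, symplJ, Matrix.fromBlocks_neg]
    rw [hJ, mul_neg, neg_mul]
    exact congrArg Neg.neg hγ.1
  exact Pform_spAct (hγ.transformsBy_zero hmem) (hi.trans (min_le_right g 4)) hτ
end
end
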